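/- arXiv:1310.5573 — 12 statements merged into one kernel-verified Lean document; each statement's English description precedes it below -/
import Mathlib

section
/- Let N and s^{1},…,s^{N} be positive integers, let A^{q,m} ∈ ℝ^{s^{q}×s^{m}} and b^{m} ∈ ℝ^{s^{m}} be GARK coefficients, and let h ∈ ℝ. Let H be a real inner product space, let Δy_n ∈ H, and for each m ∈ {1,…,N} and j ∈ {1,…,s^{m}} let Δf^{m}_j ∈ H be arbitrary. Define ΔY^{q}_i = Δy_n + h Σ_{m=1}^{N} Σ_{j=1}^{s^{m}} a^{q,m}_{ij} Δf^{m}_j and Δy_{n+1} = Δy_n + h Σ_{q=1}^{N} Σ_{i=1}^{s^{q}} b^{q}_i Δf^{q}_i. Then ‖Δy_{n+1}‖² = ‖Δy_n‖² + 2h Σ_{m=1}^{N} Σ_{i=1}^{s^{m}} b^{m}_i ⟨Δf^{m}_i, ΔY^{m}_i⟩ − h² Σ_{m,ℓ=1}^{N} Σ_{i=1}^{s^{m}} Σ_{j=1}^{s^{ℓ}} P^{m,ℓ}_{ij} ⟨Δf^{m}_i, Δf^{ℓ}_j⟩. -/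
open Matrix
open scoped RealInnerProductSpace

/-- The fundamental algebraic identity behind the nonlinear stability
analysis of GARK methods: for arbitrary increments `Δf`, the squared norm of the solution
difference after one step expands into the stage scalar products plus a quadratic form
in the matrices `P^{m,ℓ} = (A^{ℓ,m})ᵀ B^{ℓ} + B^{m} A^{m,ℓ} − b^{m}(b^{ℓ})ᵀ`. -/
theorem gark_energy_identity
    {H : Type*} [NormedAddCommGroup H] [InnerProductSpace ℝ H]
    (N : ℕ) (hN : 0 < N) (s : Fin N → ℕ) (hs : ∀ m, 0 < s m)
    (A : ∀ q m : Fin N, Matrix (Fin (s q)) (Fin (s m)) ℝ)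
    (b : ∀ m : Fin N, Fin (s m) → ℝ)
    (P : ∀ m ℓ : Fin N, Matrix (Fin (s m)) (Fin (s ℓ)) ℝ)
    (hP : ∀ m ℓ, P m ℓ =
      (A ℓ m)ᵀ * Matrix.diagonal (b ℓ) + Matrix.diagonal (b m) * A m ℓ
        - Matrix.vecMulVec (b m) (b ℓ))
    (h : ℝ) (Δy : H) (Δf : ∀ m : Fin N, Fin (s m) → H)
    (ΔY : ∀ q : Fin N, Fin (s q) → H)
    (hΔY : ∀ q i, ΔY q i = Δy + h • ∑ m, ∑ j, A q m i j • Δf m j)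
    (Δy' : H)
    (hΔy' : Δy' = Δy + h • ∑ q, ∑ i, b q i • Δf q i) :
    ‖Δy'‖ ^ 2 = ‖Δy‖ ^ 2
      + 2 * h * ∑ m, ∑ i, b m i * ⟪Δf m i, ΔY m i⟫
      - h ^ 2 * ∑ m, ∑ ℓ, ∑ i, ∑ j, P m ℓ i j * ⟪Δf m i, Δf ℓ j⟫ := by
  obtain ⟨S, hS⟩ : ∃ S : H, S = ∑ q, ∑ i, b q i • Δf q i := ⟨_, rfl⟩
  obtain ⟨Q, hQ⟩ : ∃ Q : ℝ, Q = ∑ m, ∑ ℓ, ∑ i, ∑ j,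
      b m i * A m ℓ i j * ⟪Δf m i, Δf ℓ j⟫ := ⟨_, rfl⟩
  have hSS : ⟪S, S⟫ = ∑ m, ∑ ℓ, ∑ i, ∑ j, b m i * b ℓ j * ⟪Δf m i, Δf ℓ j⟫ := by
    rw [hS]
    simp only [sum_inner]
    refine Finset.sum_congr rfl fun m _ => ?_
    rw [Finset.sum_comm]
    refine Finset.sum_congr rfl fun i _ => ?_
    simp only [inner_sum]
    refine Finset.sum_congr rfl fun l _ => Finset.sum_congr rfl fun j _ => ?_
    rw [real_inner_smul_left, real_inner_smul_right]
    ring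
  have hQ' : Q = ∑ m, ∑ ℓ, ∑ i, ∑ j, A ℓ m j i * b ℓ j * ⟪Δf m i, Δf ℓ j⟫ := by
    rw [hQ, Finset.sum_comm]
    refine Finset.sum_congr rfl fun m _ => Finset.sum_congr rfl fun l _ => ?_
    rw [Finset.sum_comm]
    refine Finset.sum_congr rfl fun i _ => Finset.sum_congr rfl fun j _ => ?_
    rw [real_inner_comm]
    ring
  have hPs : ∑ m, ∑ ℓ, ∑ i, ∑ j, P m ℓ i j * ⟪Δf m i, Δf ℓ j⟫ = Q + Q - ⟪S, S⟫ := by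
    rw [hSS]
    nth_rewrite 1 [hQ']
    rw [hQ]
    simp only [← Finset.sum_add_distrib, ← Finset.sum_sub_distrib]
    refine Finset.sum_congr rfl fun m _ => Finset.sum_congr rfl fun l _ =>
      Finset.sum_congr rfl fun i _ => Finset.sum_congr rfl fun j _ => ?_
    rw [hP]
    simp only [Matrix.sub_apply, Matrix.add_apply, Matrix.mul_diagonal, Matrix.diagonal_mul,
      Matrix.transpose_apply, Matrix.vecMulVec_apply]
    ring
  have hYs : ∑ m, ∑ i, b m i * ⟪Δf m i, ΔY m i⟫ = ⟪Δy, S⟫ + h * Q := by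
    rw [hS, hQ]
    simp only [inner_sum, Finset.mul_sum, ← Finset.sum_add_distrib]
    refine Finset.sum_congr rfl fun m _ => ?_
    rw [Finset.sum_comm (s := (Finset.univ : Finset (Fin N))), ← Finset.sum_add_distrib]
    refine Finset.sum_congr rfl fun i _ => ?_
    rw [hΔY, inner_add_right, real_inner_smul_right, real_inner_smul_right, mul_add,
      real_inner_comm]
    simp only [inner_sum, Finset.mul_sum, real_inner_smul_right]
    congr 1
    refine Finset.sum_congr rfl fun l _ => Finset.sum_congr rfl fun j _ => ?_
    ring
  rw [hPs, hYs, hΔy', ← hS, norm_add_sq_real, real_inner_smul_right,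
    ← real_inner_self_eq_norm_sq (h • S), real_inner_smul_left, real_inner_smul_right]
  ring
end

section
/- Let H be a real inner product space and for m ∈ {1,…,N} let f^{m} : H → H satisfy the dispersivity condition ⟨f^{m}(u) − f^{m}(v), u − v⟩ ≤ ν^{m} ‖u − v‖² for all u,v ∈ H, with constants ν^{m} ≤ 0. Suppose the GARK method is algebraically stable, i.e. b^{m}_i ≥ 0 for all m, i, and the symmetric block matrix P = (P^{m,ℓ})_{1≤m,ℓ≤N} is positive semidefinite. Let h > 0, let y_n, ỹ_n ∈ H, and suppose Y^{q}_i and Ỹ^{q}_i are stage values satisfying the GARK stage equations for the starting values y_n and ỹ_n respectively, with updates y_{n+1} and ỹ_{n+1} given by the GARK update formula. Then ‖ỹ_{n+1} − y_{n+1}‖ ≤ ‖ỹ_n − y_n‖. -/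
open Matrix
open scoped RealInnerProductSpace

open scoped MatrixOrder Matrix.Norms.L2Operator in
lemma gark_psd {H ι : Type*} [NormedAddCommGroup H] [InnerProductSpace ℝ H] [Fintype ι]
    (Q : Matrix ι ι ℝ) (hQ : Q.PosSemidef) (K : ι → H) :
    0 ≤ ∑ p, ∑ q, Q p q * ⟪K p, K q⟫ := by
  classical
  obtain ⟨M, rfl⟩ : ∃ M : Matrix ι ι ℝ, Q = Mᴴ * M :=
    CStarAlgebra.nonneg_iff_eq_star_mul_self.mp hQ.nonneg
  have : ∑ p, ∑ q, (Mᴴ * M) p q * ⟪K p, K q⟫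
      = ∑ k, ⟪∑ p, M k p • K p, ∑ q, M k q • K q⟫ := by
    simp only [sum_inner, inner_sum, real_inner_smul_left, real_inner_smul_right,
      Matrix.mul_apply, Matrix.conjTranspose_apply, star_trivial, Finset.sum_mul]
    have l : ∀ g : ι → ι → ι → ℝ, ∑ p, ∑ q, ∑ k, g p q k = ∑ k, ∑ p, ∑ q, g p q k := by
      intro g
      rw [Finset.sum_comm (s := Finset.univ (α := ι)) (f := fun k p => ∑ q, g p q k)]
      exact Finset.sum_congr rfl fun p _ => Finset.sum_comm
    rw [l]
    refine Finset.sum_congr rfl fun k _ => ?_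
    rw [Finset.sum_comm]
    refine Finset.sum_congr rfl fun p _ => Finset.sum_congr rfl fun q _ => ?_
    first | ring | (rw [real_inner_comm]; ring)
  rw [this]
  exact Finset.sum_nonneg fun k _ => real_inner_self_nonneg

lemma gark_core {H ι : Type*} [NormedAddCommGroup H] [InnerProductSpace ℝ H] [Fintype ι]
    (Q : Matrix ι ι ℝ) (hQ : Q.PosSemidef) (a : ι → ι → ℝ) (b : ι → ℝ)
    (hdef : ∀ p q, Q p q = a q p * b q + b p * a p q - b p * b q)
    (hb : ∀ p, 0 ≤ b p) (h : ℝ) (hh : 0 < h) (d0 d1 : H) (K D : ι → H)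
    (hD : ∀ p, D p = d0 + h • ∑ q, a p q • K q)
    (hK : ∀ p, ⟪K p, D p⟫ ≤ 0)
    (h1 : d1 = d0 + h • ∑ p, b p • K p) : ‖d1‖ ≤ ‖d0‖ := by
  have h2 := gark_psd Q hQ K
  have hS : ∑ p, b p * ⟪K p, D p⟫ ≤ 0 :=
    Finset.sum_nonpos fun p _ => mul_nonpos_of_nonneg_of_nonpos (hb p) (hK p)
  have e1 : ∑ p, b p * ⟪K p, D p⟫
      = ∑ p, b p * ⟪K p, d0⟫ + h * ∑ p, ∑ q, b p * a p q * ⟪K p, K q⟫ := by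
    simp only [hD, inner_add_right, inner_sum, real_inner_smul_right, mul_add,
      Finset.sum_add_distrib, Finset.mul_sum]
    congr 1
    refine Finset.sum_congr rfl fun p _ => Finset.sum_congr rfl fun q _ => by ring
  have e2 : ∑ p, ∑ q, a q p * b q * ⟪K p, K q⟫ = ∑ p, ∑ q, b p * a p q * ⟪K p, K q⟫ := by
    rw [Finset.sum_comm]
    refine Finset.sum_congr rfl fun p _ => Finset.sum_congr rfl fun q _ => ?_
    rw [real_inner_comm]; ring
  have e3 : ∑ p, ∑ q, Q p q * ⟪K p, K q⟫ = 2 * ∑ p, ∑ q, b p * a p q * ⟪K p, K q⟫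
      - ∑ p, ∑ q, b p * b q * ⟪K p, K q⟫ := by
    simp only [hdef, sub_mul, add_mul, Finset.sum_sub_distrib, Finset.sum_add_distrib]
    rw [e2]; ring
  have e4 : ‖∑ p, b p • K p‖ ^ 2 = ∑ p, ∑ q, b p * b q * ⟪K p, K q⟫ := by
    rw [← real_inner_self_eq_norm_sq]
    simp only [sum_inner, inner_sum, real_inner_smul_left, real_inner_smul_right]
    rw [Finset.sum_comm]
    refine Finset.sum_congr rfl fun p _ => Finset.sum_congr rfl fun q _ => ?_
    rw [real_inner_comm]; ring
  have e5 : ⟪d0, ∑ p, b p • K p⟫ = ∑ p, b p * ⟪K p, d0⟫ := by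
    simp only [inner_sum, real_inner_smul_right, real_inner_comm]
  have e6 : ‖d1‖ ^ 2 = ‖d0‖ ^ 2 + 2 * (h * ∑ p, b p * ⟪K p, d0⟫)
      + h ^ 2 * ∑ p, ∑ q, b p * b q * ⟪K p, K q⟫ := by
    rw [h1, norm_add_sq_real, real_inner_smul_right, e5, norm_smul, mul_pow, e4,
      Real.norm_eq_abs, sq_abs]
  refine (sq_le_sq₀ (norm_nonneg _) (norm_nonneg _)).mp ?_
  rw [e3] at h2
  rw [e1] at hS
  have := mul_nonneg (sq_nonneg h) h2
  have := mul_nonpos_of_nonneg_of_nonpos hh.le hS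
  rw [e6]
  nlinarith

/-- Algebraic stability of GARK methods: if all component functions are
dispersive, all weights are nonnegative and the symmetric block matrix
`P = (P^{m,ℓ})` is positive semidefinite, then the GARK step is unconditionally
contractive: `‖ỹ_{n+1} − y_{n+1}‖ ≤ ‖ỹ_n − y_n‖`. -/
theorem gark_algebraic_stability
    {H : Type*} [NormedAddCommGroup H] [InnerProductSpace ℝ H]
    (N : ℕ) (hN : 0 < N) (s : Fin N → ℕ) (hs : ∀ m, 0 < s m)
    (A : ∀ q m : Fin N, Matrix (Fin (s q)) (Fin (s m)) ℝ)
    (b : ∀ m : Fin N, Fin (s m) → ℝ)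
    (P : ∀ m ℓ : Fin N, Matrix (Fin (s m)) (Fin (s ℓ)) ℝ)
    (hPdef : ∀ m ℓ, P m ℓ =
      (A ℓ m)ᵀ * Matrix.diagonal (b ℓ) + Matrix.diagonal (b m) * A m ℓ
        - Matrix.vecMulVec (b m) (b ℓ))
    (f : Fin N → H → H) (ν : Fin N → ℝ) (hν : ∀ m, ν m ≤ 0)
    (hdisp : ∀ m u v, ⟪f m u - f m v, u - v⟫ ≤ ν m * ‖u - v‖ ^ 2)
    (hb : ∀ m i, 0 ≤ b m i)
    (hPsd : Matrix.PosSemidef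
      (Matrix.of fun p q : (Σ m : Fin N, Fin (s m)) => P p.1 q.1 p.2 q.2))
    (h : ℝ) (hh : 0 < h)
    (yn ytn : H)
    (Y Yt : ∀ q : Fin N, Fin (s q) → H)
    (hY : ∀ q i, Y q i = yn + h • ∑ m, ∑ j, A q m i j • f m (Y m j))
    (hYt : ∀ q i, Yt q i = ytn + h • ∑ m, ∑ j, A q m i j • f m (Yt m j))
    (yn1 ytn1 : H)
    (hy1 : yn1 = yn + h • ∑ q, ∑ i, b q i • f q (Y q i))
    (hyt1 : ytn1 = ytn + h • ∑ q, ∑ i, b q i • f q (Yt q i)) :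
    ‖ytn1 - yn1‖ ≤ ‖ytn - yn‖ := by
  refine gark_core _ hPsd (fun p q => A p.1 q.1 p.2 q.2) (fun p => b p.1 p.2) ?_
    (fun p => hb _ _) h hh (ytn - yn) (ytn1 - yn1)
    (fun p => f p.1 (Yt p.1 p.2) - f p.1 (Y p.1 p.2))
    (fun p => Yt p.1 p.2 - Y p.1 p.2) ?_ ?_ ?_
  · intro p q
    simp [hPdef, Matrix.vecMulVec_apply]
  · intro p
    rw [hY p.1 p.2, hYt p.1 p.2]
    simp only [Fintype.sum_sigma, smul_sub, Finset.sum_sub_distrib]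
    abel
  · intro p
    exact (hdisp _ _ _).trans (mul_nonpos_of_nonpos_of_nonneg (hν _) (sq_nonneg _))
  · rw [hy1, hyt1]
    simp only [Fintype.sum_sigma, smul_sub, Finset.sum_sub_distrib]
    abel
end

section
/- Let H be a real inner product space and for m ∈ {1,…,N} let f^{m} : H → H satisfy the coercivity condition ⟨f^{m}(u) − f^{m}(v), u − v⟩ ≤ μ^{m} ‖f^{m}(u) − f^{m}(v)‖² for all u,v ∈ H, with constants μ^{m} < 0. Suppose all weights satisfy b^{m}_i ≥ 0 and there exist r^{m} ≥ 0 such that the matrix P̃ = P + blockdiag(r^{1}B^{1},…,r^{N}B^{N}) is positive semidefinite. Let h > 0 satisfy 2μ^{m} + h r^{m} ≤ 0 for every m. If Y^{q}_i and Ỹ^{q}_i are stage values satisfying the GARK stage equations for starting values y_n and ỹ_n respectively, with updates y_{n+1} and ỹ_{n+1} given by the GARK update formula, then ‖ỹ_{n+1} − y_{n+1}‖ ≤ ‖ỹ_n − y_n‖. -/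
open Matrix
open scoped RealInnerProductSpace

theorem gark_aux_psd {H ι : Type*} [NormedAddCommGroup H] [InnerProductSpace ℝ H] [Fintype ι]
    [DecidableEq ι]
    (M : Matrix ι ι ℝ) (hM : M.PosSemidef) (k : ι → H) :
    0 ≤ ∑ p, ∑ q, M p q * ⟪k p, k q⟫ := by
  obtain ⟨B, rfl⟩ : ∃ B : Matrix ι ι ℝ, M = Bᴴ * B := by
    open scoped MatrixOrder in
    exact CStarAlgebra.nonneg_iff_eq_star_mul_self.mp hM.nonneg
  have : ∑ p, ∑ q, (Bᴴ * B) p q * ⟪k p, k q⟫ = ∑ l, ⟪∑ p, B l p • k p, ∑ q, B l q • k q⟫ := by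
    simp only [sum_inner, inner_sum, real_inner_smul_left, real_inner_smul_right,
      Matrix.mul_apply, Matrix.conjTranspose_apply, star_trivial, Finset.sum_mul]
    rw [Finset.sum_comm]
    conv_rhs => rw [Finset.sum_comm]
    conv_rhs =>
      enter [2, p]
      rw [Finset.sum_comm]
    rw [Finset.sum_comm]
    refine Finset.sum_congr rfl fun p _ => Finset.sum_congr rfl fun q _ =>
      Finset.sum_congr rfl fun l _ => ?_
    rw [real_inner_comm]; ring
  rw [this]
  exact Finset.sum_nonneg fun l _ => real_inner_self_nonneg

theorem gark_aux {H ι : Type*} [NormedAddCommGroup H] [InnerProductSpace ℝ H] [Fintype ι]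
    [DecidableEq ι]
    (a : ι → ι → ℝ) (b r μ : ι → ℝ) (hb : ∀ p, 0 ≤ b p) (h : ℝ) (hh : 0 < h)
    (hstep : ∀ p, 2 * μ p + h * r p ≤ 0) (M : Matrix ι ι ℝ) (hM : M.PosSemidef)
    (hMd : ∀ p q, M p q = a q p * b q + b p * a p q - b p * b q + if p = q then r p * b p else 0)
    (d0 d1 : H) (k D : ι → H) (hco : ∀ p, ⟪k p, D p⟫ ≤ μ p * ‖k p‖ ^ 2)
    (hD : ∀ p, D p = d0 + h • ∑ q, a p q • k q)
    (h1 : d1 = d0 + h • ∑ p, b p • k p) : ‖d1‖ ≤ ‖d0‖ := by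
  have hQ := gark_aux_psd M hM k
  have e1 : ∑ p, ∑ q, M p q * ⟪k p, k q⟫ = 2 * (∑ p, ∑ q, b p * a p q * ⟪k p, k q⟫)
      - ∑ p, ∑ q, b p * b q * ⟪k p, k q⟫ + ∑ p, r p * b p * ‖k p‖ ^ 2 := by
    have c : ∑ p, ∑ q, a q p * b q * ⟪k p, k q⟫ = ∑ p, ∑ q, b p * a p q * ⟪k p, k q⟫ := by
      rw [Finset.sum_comm]
      refine Finset.sum_congr rfl fun p _ => Finset.sum_congr rfl fun q _ => ?_
      rw [real_inner_comm]; ring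
    simp only [hMd, add_mul, sub_mul, Finset.sum_add_distrib, Finset.sum_sub_distrib, c,
      ite_mul, zero_mul, Finset.sum_ite_eq, Finset.mem_univ, if_true, real_inner_self_eq_norm_sq]
    ring
  have e2 : ∑ p, b p * ⟪k p, D p⟫ = ∑ p, b p * ⟪d0, k p⟫
      + h * ∑ p, ∑ q, b p * a p q * ⟪k p, k q⟫ := by
    rw [Finset.mul_sum, ← Finset.sum_add_distrib]
    refine Finset.sum_congr rfl fun p _ => ?_
    rw [hD, inner_add_right, real_inner_smul_right, inner_sum, real_inner_comm]
    simp only [real_inner_smul_right, mul_assoc, ← Finset.mul_sum]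
    ring
  have e3 : ‖d1‖ ^ 2 = ‖d0‖ ^ 2 + 2 * h * (∑ p, b p * ⟪d0, k p⟫)
      + h ^ 2 * ∑ p, ∑ q, b p * b q * ⟪k p, k q⟫ := by
    have c : ‖∑ p, b p • k p‖ ^ 2 = ∑ p, ∑ q, b p * b q * ⟪k p, k q⟫ := by
      rw [← real_inner_self_eq_norm_sq, sum_inner]
      refine Finset.sum_congr rfl fun p _ => ?_
      rw [inner_sum]
      refine Finset.sum_congr rfl fun q _ => ?_
      rw [real_inner_smul_left, real_inner_smul_right]; ring
    rw [h1, norm_add_sq_real, norm_smul, mul_pow, c, real_inner_smul_right, inner_sum]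
    simp only [real_inner_smul_right, Real.norm_eq_abs, sq_abs]
    ring
  have e4 : 2 * (∑ p, b p * ⟪k p, D p⟫) + h * ∑ p, r p * b p * ‖k p‖ ^ 2 ≤ 0 := by
    rw [Finset.mul_sum, Finset.mul_sum, ← Finset.sum_add_distrib]
    refine Finset.sum_nonpos fun p _ => ?_
    have i1 := mul_le_mul_of_nonneg_left (hco p) (hb p)
    have i2 := mul_nonpos_of_nonpos_of_nonneg (hstep p) (mul_nonneg (hb p) (sq_nonneg ‖k p‖))
    linarith
  rw [e1] at hQ
  rw [e2] at e4
  have i3 := mul_nonpos_of_nonneg_of_nonpos hh.le e4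
  have i4 := mul_nonneg (sq_nonneg h) hQ
  refine (sq_le_sq₀ (norm_nonneg _) (norm_nonneg _)).mp ?_
  rw [e3]
  linarith

/-- Conditional nonlinear stability of GARK methods for coercive
problems: if the weights are nonnegative and `P̃ = P + blockdiag(r^{m}B^{m})` is
positive semidefinite for some `r^{m} ≥ 0`, then the GARK step is contractive under the
step size restriction `2μ^{m} + h r^{m} ≤ 0` for all `m`. -/
theorem gark_conditional_stability
    {H : Type*} [NormedAddCommGroup H] [InnerProductSpace ℝ H]
    (N : ℕ) (hN : 0 < N) (s : Fin N → ℕ) (hs : ∀ m, 0 < s m)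
    (A : ∀ q m : Fin N, Matrix (Fin (s q)) (Fin (s m)) ℝ)
    (b : ∀ m : Fin N, Fin (s m) → ℝ)
    (P : ∀ m ℓ : Fin N, Matrix (Fin (s m)) (Fin (s ℓ)) ℝ)
    (hPdef : ∀ m ℓ, P m ℓ =
      (A ℓ m)ᵀ * Matrix.diagonal (b ℓ) + Matrix.diagonal (b m) * A m ℓ
        - Matrix.vecMulVec (b m) (b ℓ))
    (f : Fin N → H → H) (μ : Fin N → ℝ) (hμ : ∀ m, μ m < 0)
    (hcoer : ∀ m u v, ⟪f m u - f m v, u - v⟫ ≤ μ m * ‖f m u - f m v‖ ^ 2)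
    (hb : ∀ m i, 0 ≤ b m i)
    (r : Fin N → ℝ) (hr : ∀ m, 0 ≤ r m)
    (hPsd : Matrix.PosSemidef
      (Matrix.of fun p q : (Σ m : Fin N, Fin (s m)) =>
        P p.1 q.1 p.2 q.2 + if p = q then r p.1 * b p.1 p.2 else 0))
    (h : ℝ) (hh : 0 < h)
    (hstep : ∀ m, 2 * μ m + h * r m ≤ 0)
    (yn ytn : H)
    (Y Yt : ∀ q : Fin N, Fin (s q) → H)
    (hY : ∀ q i, Y q i = yn + h • ∑ m, ∑ j, A q m i j • f m (Y m j))
    (hYt : ∀ q i, Yt q i = ytn + h • ∑ m, ∑ j, A q m i j • f m (Yt m j))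
    (yn1 ytn1 : H)
    (hy1 : yn1 = yn + h • ∑ q, ∑ i, b q i • f q (Y q i))
    (hyt1 : ytn1 = ytn + h • ∑ q, ∑ i, b q i • f q (Yt q i)) :
    ‖ytn1 - yn1‖ ≤ ‖ytn - yn‖ := by
  refine gark_aux (ι := Σ m : Fin N, Fin (s m)) (fun p q => A p.1 q.1 p.2 q.2)
    (fun p => b p.1 p.2) (fun p => r p.1) (fun p => μ p.1) (fun p => hb _ _) h hh
    (fun p => hstep _) _ hPsd ?_ _ _ (fun p => f p.1 (Yt p.1 p.2) - f p.1 (Y p.1 p.2))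
    (fun p => Yt p.1 p.2 - Y p.1 p.2) (fun p => hcoer _ _ _) ?_ ?_
  · intro p q
    simp [hPdef, Matrix.vecMulVec_apply]
  · rintro ⟨q, i⟩
    simp only [Fintype.sum_sigma, smul_sub, Finset.sum_sub_distrib]
    rw [hY q i, hYt q i]
    abel
  · rw [hy1, hyt1]
    simp only [Fintype.sum_sigma, smul_sub, Finset.sum_sub_distrib]
    abel
end

section
/- Let H be a real normed vector space and for m ∈ {1,…,N} let f^{m} : H → H and ρ^{m} > 0 satisfy ‖y + ρ^{m} f^{m}(y)‖ ≤ ‖y‖ for all y ∈ H. Then for every θ with 0 < θ ≤ (min_{m} ρ^{m})/N and every y ∈ H, ‖y + θ Σ_{m=1}^{N} f^{m}(y)‖ ≤ ‖y‖. -/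
/-- If each component vector field `f^{m}` admits a monotone forward Euler
step of size `ρ^{m} > 0`, then a forward Euler step with the full right hand side
`Σ_m f^{m}` is monotone for any step size `θ` with `0 < θ ≤ (min_m ρ^{m})/N`. -/
theorem euler_monotone_sum
    {H : Type*} [NormedAddCommGroup H] [NormedSpace ℝ H]
    (N : ℕ) (hN : 0 < N) (f : Fin N → H → H) (ρ : Fin N → ℝ)
    (hρ : ∀ m, 0 < ρ m)
    (hf : ∀ m y, ‖y + ρ m • f m y‖ ≤ ‖y‖)
    (θ : ℝ) (hθ : 0 < θ) (hθ2 : θ ≤ (⨅ m, ρ m) / N) :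
    ∀ y : H, ‖y + θ • ∑ m, f m y‖ ≤ ‖y‖ := by
  intro y
  have hN' : (0 : ℝ) < N := by exact_mod_cast hN
  have hle : ∀ m, θ / ρ m ≤ (N : ℝ)⁻¹ := by
    intro m
    have h1 : (⨅ m, ρ m) ≤ ρ m := ciInf_le (Set.finite_range ρ).bddBelow m
    have h2 : θ * N ≤ ρ m := ((le_div_iff₀ hN').1 hθ2).trans h1
    rw [div_le_iff₀ (hρ m), inv_mul_eq_div, le_div_iff₀ hN']
    exact h2
  have hterm : ∀ m, (((N : ℝ)⁻¹ - θ / ρ m) • y + (θ / ρ m) • (y + ρ m • f m y))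
      = (N : ℝ)⁻¹ • y + θ • f m y := by
    intro m
    rw [smul_add, smul_smul, div_mul_cancel₀ _ (hρ m).ne', sub_smul]
    abel
  have heq : y + θ • ∑ m, f m y
      = ∑ m, (((N : ℝ)⁻¹ - θ / ρ m) • y + (θ / ρ m) • (y + ρ m • f m y)) := by
    simp only [hterm]
    rw [Finset.sum_add_distrib, ← Finset.smul_sum, Finset.sum_const, Finset.card_univ,
      Fintype.card_fin, ← Nat.cast_smul_eq_nsmul ℝ, smul_smul, inv_mul_cancel₀ hN'.ne', one_smul, Finset.smul_sum]
  rw [heq]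
  calc _ ≤ ∑ m : Fin N, (N : ℝ)⁻¹ * ‖y‖ := by
        refine norm_sum_le_of_le _ fun m _ => ?_
        have h0 : 0 ≤ θ / ρ m := (div_pos hθ (hρ m)).le
        refine (norm_add_le _ _).trans ?_
        rw [norm_smul, norm_smul, Real.norm_of_nonneg (sub_nonneg.2 (hle m)),
          Real.norm_of_nonneg h0]
        have := mul_le_mul_of_nonneg_left (hf m y) h0
        linarith
    _ = ‖y‖ := by
        rw [Finset.sum_const, Finset.card_univ, Fintype.card_fin, nsmul_eq_mul,
          mul_inv_cancel_left₀ hN'.ne']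
end

section
/- Consider a GARK method whose coefficients are all nonnegative, a^{q,m}_{ij} ≥ 0 and b^{m}_i ≥ 0 for all indices. Let ŝ = s^{1} + ⋯ + s^{N} + 1, let Â ∈ ℝ^{ŝ×ŝ} be the matrix with block rows (A^{q,1},…,A^{q,N},0) for q = 1,…,N and last row ((b^{1})ᵀ,…,(b^{N})ᵀ,0), and for r^{1},…,r^{N} > 0 let R̂ = diag(r^{1}I_{s^{1}},…,r^{N}I_{s^{N}},1). Assume I + ÂR̂ is invertible and the method is absolutely monotonic at r: α(r) = (I + ÂR̂)^{−1}𝟙 ≥ 0 and β(r) = (I + ÂR̂)^{−1}ÂR̂ ≥ 0 entrywise. Let H be a real normed vector space and f^{m} : H → H satisfy ‖y + τ f^{m}(y)‖ ≤ ‖y‖ for all y ∈ H and all 0 ≤ τ ≤ ρ^{m}, with ρ^{m} > 0. Let h > 0 satisfy h ≤ r^{q} ρ^{q} for every q. If y_n ∈ H and the stage values Y^{q}_i satisfy the GARK stage equations with the update y_{n+1} given by the GARK update formula, then ‖Y^{q}_i‖ ≤ ‖y_n‖ for all q, i, and ‖y_{n+1}‖ ≤ ‖y_n‖. -/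
open Matrix

theorem aux_mono {H ι : Type*} [NormedAddCommGroup H] [NormedSpace ℝ H]
    [Fintype ι] [DecidableEq ι] (M : Matrix ι ι ℝ) (hM : ∀ p q, 0 ≤ M p q)
    (hinv : IsUnit (1 + M).det)
    (halpha : ∀ p, 0 ≤ ((1 + M)⁻¹ *ᵥ fun _ => (1 : ℝ)) p)
    (hbeta : ∀ p q, 0 ≤ ((1 + M)⁻¹ * M) p q)
    (y : H) (Z F : ι → H) (hZ : ∀ p, Z p = y + ∑ q, M p q • F q)
    (hF : ∀ q, ‖Z q + F q‖ ≤ ‖Z q‖) (p : ι) : ‖Z p‖ ≤ ‖y‖ := by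
  set P := (1 + M)⁻¹ with hP
  have hPM : P * (1 + M) = 1 := Matrix.nonsing_inv_mul _ hinv
  have hMP : (1 + M) * P = 1 := Matrix.mul_nonsing_inv _ hinv
  have h1 : ∀ p, Z p = (P *ᵥ fun _ => (1 : ℝ)) p • y + ∑ q, (P * M) p q • (Z q + F q) := by
    intro p
    have e0 : ∀ q, Z q + ∑ k, M q k • Z k = y + ∑ k, M q k • (Z k + F k) := by
      intro q
      simp only [smul_add, Finset.sum_add_distrib]
      nth_rewrite 1 [hZ q]
      abel
    have e1 : ∀ W : ι → H, ∑ k, (P * M) p k • W k = ∑ q, P p q • ∑ k, M q k • W k := by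
      intro W
      simp only [Matrix.mul_apply, Finset.sum_smul, Finset.smul_sum, mul_smul]
      rw [Finset.sum_comm]
    have e2 : Z p = ∑ q, P p q • (Z q + ∑ k, M q k • Z k) := by
      simp only [smul_add, Finset.sum_add_distrib]
      rw [← e1, ← Finset.sum_add_distrib]
      have : ∀ k, P p k • Z k + (P * M) p k • Z k = (1 : Matrix ι ι ℝ) p k • Z k := by
        intro k
        rw [← add_smul, ← Matrix.add_apply, ← hPM, mul_add, mul_one]
      simp [this, Matrix.one_apply]
    rw [e1, e2]
    simp only [e0]
    simp only [smul_add, Finset.sum_add_distrib, Matrix.mulVec, dotProduct, mul_one,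
      Finset.sum_smul]
  have h2 : ∀ p, ‖Z p‖ ≤ (P *ᵥ fun _ => (1 : ℝ)) p * ‖y‖ + ∑ q, (P * M) p q * ‖Z q‖ := by
    intro p
    calc ‖Z p‖ = ‖(P *ᵥ fun _ => (1 : ℝ)) p • y + ∑ q, (P * M) p q • (Z q + F q)‖ := by
          rw [← h1 p]
      _ ≤ _ := by
          refine (norm_add_le _ _).trans (add_le_add ?_ ?_)
          · rw [norm_smul, Real.norm_of_nonneg (halpha p)]
          · refine (norm_sum_le _ _).trans (Finset.sum_le_sum fun q _ => ?_)
            rw [norm_smul, Real.norm_of_nonneg (hbeta p q)]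
            exact mul_le_mul_of_nonneg_left (hF q) (hbeta p q)
  set n : ι → ℝ := fun q => ‖Z q‖ with hn
  have hw : ∀ p, 0 ≤ (P *ᵥ (‖y‖ • (fun _ => (1 : ℝ)) - n)) p := by
    intro p
    have e : P = 1 - P * M := by
      rw [mul_add, mul_one] at hPM
      exact eq_sub_of_add_eq hPM
    have e3 : P *ᵥ n = n - (P * M) *ᵥ n := by
      conv_lhs => rw [e]
      rw [Matrix.sub_mulVec, Matrix.one_mulVec]
    rw [Matrix.mulVec_sub, Matrix.mulVec_smul, e3]
    have h3 := h2 p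
    have e4 : ((P * M) *ᵥ n) p = ∑ q, (P * M) p q * ‖Z q‖ := rfl
    simp only [Pi.sub_apply, Pi.smul_apply, smul_eq_mul, e4]
    simp only [hn]
    linarith
  have h5 : (‖y‖ • (fun _ => (1 : ℝ)) - n : ι → ℝ) p
      = ((1 + M) *ᵥ (P *ᵥ (‖y‖ • (fun _ => (1 : ℝ)) - n))) p := by
    rw [Matrix.mulVec_mulVec, hMP, Matrix.one_mulVec]
  have h6 : 0 ≤ ((1 + M) *ᵥ (P *ᵥ (‖y‖ • (fun _ => (1 : ℝ)) - n))) p := by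
    rw [Matrix.add_mulVec, Matrix.one_mulVec]
    exact add_nonneg (hw p) (Finset.sum_nonneg fun q _ => mul_nonneg (hM p q) (hw q))
  rw [← h5] at h6
  simpa [hn] using h6

/-- Monotonicity of GARK solutions: for a GARK method with nonnegative
coefficients that is absolutely monotonic at `r > 0` (entrywise nonnegativity of
`α(r) = (I + ÂR̂)⁻¹𝟙` and `β(r) = (I + ÂR̂)⁻¹ÂR̂`), applied to component vector fields whose
forward Euler steps are monotone for step sizes up to `ρ^{m}`, the stages and the update
are monotone whenever `h ≤ r^{q} ρ^{q}` for every `q`. -/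
theorem gark_monotonicity
    {H : Type*} [NormedAddCommGroup H] [NormedSpace ℝ H]
    (N : ℕ) (hN : 0 < N) (s : Fin N → ℕ) (hs : ∀ m, 0 < s m)
    (A : ∀ q m : Fin N, Matrix (Fin (s q)) (Fin (s m)) ℝ)
    (b : ∀ m : Fin N, Fin (s m) → ℝ)
    (hA : ∀ q m i j, 0 ≤ A q m i j) (hb : ∀ m i, 0 ≤ b m i)
    (r : Fin N → ℝ) (hr : ∀ q, 0 < r q)
    (Ahat : Matrix ((Σ q : Fin N, Fin (s q)) ⊕ Unit) ((Σ q : Fin N, Fin (s q)) ⊕ Unit) ℝ)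
    (hAhat : Ahat = Matrix.of fun p q =>
      match p, q with
      | Sum.inl p, Sum.inl q => A p.1 q.1 p.2 q.2
      | Sum.inl _, Sum.inr _ => 0
      | Sum.inr _, Sum.inl q => b q.1 q.2
      | Sum.inr _, Sum.inr _ => 0)
    (Rhat : Matrix ((Σ q : Fin N, Fin (s q)) ⊕ Unit) ((Σ q : Fin N, Fin (s q)) ⊕ Unit) ℝ)
    (hRhat : Rhat = Matrix.diagonal (Sum.elim (fun p => r p.1) fun _ => 1))
    (hinv : IsUnit (1 + Ahat * Rhat).det)
    (halpha : ∀ p, 0 ≤ ((1 + Ahat * Rhat)⁻¹ *ᵥ fun _ => (1 : ℝ)) p)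
    (hbeta : ∀ p q, 0 ≤ ((1 + Ahat * Rhat)⁻¹ * (Ahat * Rhat)) p q)
    (f : Fin N → H → H) (ρ : Fin N → ℝ) (hρ : ∀ m, 0 < ρ m)
    (hf : ∀ m, ∀ τ : ℝ, 0 ≤ τ → τ ≤ ρ m → ∀ y, ‖y + τ • f m y‖ ≤ ‖y‖)
    (h : ℝ) (hh : 0 < h) (hstep : ∀ q, h ≤ r q * ρ q)
    (yn : H) (Y : ∀ q : Fin N, Fin (s q) → H)
    (hY : ∀ q i, Y q i = yn + h • ∑ m, ∑ j, A q m i j • f m (Y m j))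
    (y1 : H) (hy1 : y1 = yn + h • ∑ q, ∑ i, b q i • f q (Y q i)) :
    (∀ q i, ‖Y q i‖ ≤ ‖yn‖) ∧ ‖y1‖ ≤ ‖yn‖ := by
  have key := aux_mono (Ahat * Rhat) ?_ hinv halpha hbeta yn
    (Sum.elim (fun p => Y p.1 p.2) fun _ => y1)
    (Sum.elim (fun p => (h / r p.1) • f p.1 (Y p.1 p.2)) fun _ => 0) ?_ ?_
  · exact ⟨fun q i => key (Sum.inl ⟨q, i⟩), key (Sum.inr ())⟩
  · subst hAhat hRhat
    rintro (p | p) (q | q) <;> simp [Matrix.mul_diagonal]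
    · exact mul_nonneg (hA _ _ _ _) (hr _).le
    · exact mul_nonneg (hb _ _) (hr _).le
  · have hc : ∀ q (a : ℝ), a * r q * (h / r q) = h * a := by
      intro q a
      have := (hr q).ne'
      field_simp
    subst hAhat hRhat
    rintro (p | p)
    · simp [Matrix.mul_diagonal, Fintype.sum_sum_type, Fintype.sum_sigma, smul_smul, hc]
      rw [hY p.1 p.2]
      simp [Finset.smul_sum, smul_smul]
    · simp [Matrix.mul_diagonal, Fintype.sum_sum_type, Fintype.sum_sigma, smul_smul, hc]
      rw [hy1]
      simp [Finset.smul_sum, smul_smul]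
  · rintro (p | p)
    · exact hf p.1 _ (div_nonneg hh.le (hr _).le)
        ((div_le_iff₀' (hr _)).2 (hstep _)) _
    · simp
end

section
/- Let A ∈ ℝ^{s×s} be invertible, let e_s be the s-th standard basis vector of ℝ^{s}, and suppose bᵀ = e_sᵀ A (stiff accuracy). Then for all sufficiently negative z ∈ ℝ the matrix I − z A is invertible, and the stability function R(z) = 1 + z bᵀ (I − z A)^{−1} 𝟙 tends to 0 as z → −∞. -/
open Matrix Filter Topology

/-- A stiffly accurate Runge-Kutta method (`bᵀ = e_sᵀ A`, `A` invertible)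
has `I − zA` invertible for all sufficiently negative `z` and its stability function
`R(z) = 1 + z bᵀ (I − zA)⁻¹ 𝟙` tends to `0` as `z → −∞`. -/
theorem stiffly_accurate_stability_at_minus_infinity
    (n : ℕ) (A : Matrix (Fin (n + 1)) (Fin (n + 1)) ℝ) (hA : IsUnit A.det)
    (e : Fin (n + 1) → ℝ) (he : e = Pi.single (Fin.last n) 1)
    (b : Fin (n + 1) → ℝ) (hb : b = Aᵀ *ᵥ e) :
    (∀ᶠ z : ℝ in atBot, IsUnit (1 - z • A).det) ∧
    Tendsto (fun z : ℝ => 1 + z * (b ⬝ᵥ ((1 - z • A)⁻¹ *ᵥ fun _ => 1))) atBot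
      (𝓝 0) := by
  have hM : Continuous (fun w : ℝ => w • (1 : Matrix (Fin (n + 1)) (Fin (n + 1)) ℝ) - A) := by
    fun_prop
  have hdet : Continuous (fun w : ℝ =>
      (w • (1 : Matrix (Fin (n + 1)) (Fin (n + 1)) ℝ) - A).det) := hM.matrix_det
  have hadj : Continuous (fun w : ℝ =>
      (w • (1 : Matrix (Fin (n + 1)) (Fin (n + 1)) ℝ) - A).adjugate) := hM.matrix_adjugate
  have h0 : ((0 : ℝ) • (1 : Matrix (Fin (n + 1)) (Fin (n + 1)) ℝ) - A).det ≠ 0 := by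
    rw [zero_smul, zero_sub, Matrix.det_neg]
    exact mul_ne_zero (pow_ne_zero _ (by norm_num)) hA.ne_zero
  have hinv : Tendsto (fun z : ℝ => z⁻¹) atBot (𝓝 0) := tendsto_inv_atBot_zero
  have hev : ∀ᶠ z : ℝ in atBot,
      (z⁻¹ • (1 : Matrix (Fin (n + 1)) (Fin (n + 1)) ℝ) - A).det ≠ 0 :=
    hinv.eventually (hdet.continuousAt.eventually_ne h0)
  have hfac : ∀ z : ℝ, z ≠ 0 → 1 - z • A =
      z • (z⁻¹ • (1 : Matrix (Fin (n + 1)) (Fin (n + 1)) ℝ) - A) := by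
    intro z hz
    rw [smul_sub, smul_smul, mul_inv_cancel₀ hz, one_smul]
  have hunit : ∀ᶠ z : ℝ in atBot, IsUnit (1 - z • A).det := by
    filter_upwards [hev, eventually_lt_atBot (0 : ℝ)] with z h1 h2
    rw [hfac z h2.ne, Matrix.det_smul]
    exact (mul_ne_zero (pow_ne_zero _ h2.ne) h1).isUnit
  refine ⟨hunit, ?_⟩
  have hv : Continuous (fun w : ℝ => e ⬝ᵥ
      ((w • (1 : Matrix (Fin (n + 1)) (Fin (n + 1)) ℝ) - A).adjugate *ᵥ fun _ => 1)) :=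
    continuous_const.dotProduct (hadj.matrix_mulVec continuous_const)
  have hlim : Tendsto (fun w : ℝ =>
      w * ((w • (1 : Matrix (Fin (n + 1)) (Fin (n + 1)) ℝ) - A).det⁻¹ * (e ⬝ᵥ
      ((w • (1 : Matrix (Fin (n + 1)) (Fin (n + 1)) ℝ) - A).adjugate *ᵥ fun _ => 1))))
      (𝓝 0) (𝓝 0) := by
    have h := (continuousAt_id (x := (0 : ℝ))).mul
      ((hdet.continuousAt.inv₀ h0).mul hv.continuousAt)
    have h' := h.tendsto
    simp only [Pi.mul_apply, id_eq, zero_mul] at h'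
    exact h'
  refine (hlim.comp hinv).congr' ?_
  filter_upwards [hev, hunit, eventually_lt_atBot (0 : ℝ)] with z h1 hu h2
  have hI : (1 - z • A)⁻¹ = z⁻¹ •
      ((z⁻¹ • (1 : Matrix (Fin (n + 1)) (Fin (n + 1)) ℝ) - A).det⁻¹ •
        (z⁻¹ • (1 : Matrix (Fin (n + 1)) (Fin (n + 1)) ℝ) - A).adjugate) := by
    apply Matrix.inv_eq_right_inv
    rw [hfac z h2.ne, Matrix.smul_mul, Matrix.mul_smul, Matrix.mul_smul, Matrix.mul_adjugate,
      smul_smul, smul_smul, smul_smul, mul_inv_cancel₀ h2.ne, one_mul, inv_mul_cancel₀ h1,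
      one_smul]
  have hR : 1 + z * (b ⬝ᵥ ((1 - z • A)⁻¹ *ᵥ fun _ => 1)) =
      e ⬝ᵥ ((1 - z • A)⁻¹ *ᵥ fun _ => 1) := by
    have key : ((1 - z • A) * (1 - z • A)⁻¹) *ᵥ (fun _ => (1 : ℝ)) = fun _ => 1 := by
      rw [Matrix.mul_nonsing_inv _ hu, Matrix.one_mulVec]
    rw [← Matrix.mulVec_mulVec, Matrix.sub_mulVec, Matrix.one_mulVec, Matrix.smul_mulVec] at key
    have k2 := congrArg (fun v => e ⬝ᵥ v) key
    simp only [dotProduct_sub, dotProduct_smul, smul_eq_mul] at k2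
    have he1 : e ⬝ᵥ (fun _ => (1 : ℝ)) = 1 := by
      rw [he, single_dotProduct, one_mul]
    rw [he1] at k2
    rw [hb, Matrix.mulVec_transpose, ← Matrix.dotProduct_mulVec]
    linarith
  rw [hR, hI]
  simp only [Function.comp, Matrix.smul_mulVec, dotProduct_smul, smul_eq_mul]
end

section
/- Let A^{EE} ∈ ℝ^{s^{E}×s^{E}}, A^{IE} ∈ ℝ^{s^{I}×s^{E}}, A^{II} ∈ ℝ^{s^{I}×s^{I}} with A^{II} invertible, and b^{E} ∈ ℝ^{s^{E}}, b^{I} ∈ ℝ^{s^{I}}. Set c^{EE} = A^{EE}𝟙, c^{IE} = A^{IE}𝟙. Let q ≥ 1 and assume the explicit quadrature conditions (b^{E})ᵀ (c^{EE})^{k−1} = 1/k for k = 1,…,q (powers taken componentwise) and the stiff order conditions k (b^{I})ᵀ (A^{II})^{−1} A^{IE} (c^{EE})^{k−1} = (b^{I})ᵀ (A^{II})^{−1} (c^{IE})^{k} for k = 1,…,q. Let φ : ℝ → ℝ be a polynomial of degree ≤ q, let h > 0, t_n ∈ ℝ, y_n ∈ ℝ. For μ < 0 such that I − hμA^{II}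 is invertible, define Z(μ) = (I − hμA^{II})^{−1} ( y_n 𝟙 + h A^{IE} φ'(t_n 𝟙 + h c^{EE}) − hμ A^{II} φ(t_n 𝟙 + h c^{IE}) ) where φ and φ' are applied componentwise, and y_{n+1}(μ) = y_n + h (b^{E})ᵀ φ'(t_n 𝟙 + h c^{EE}) + hμ (b^{I})ᵀ ( Z(μ) − φ(t_n 𝟙 + h c^{IE}) ). Then as μ → −∞, y_{n+1}(μ) − φ(t_n + h) tends to R_∞ · (y_n − φ(t_n)), where R_∞ = 1 − (b^{I})ᵀ (A^{II})^{−1} 𝟙. -/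
open Matrix Filter Topology Polynomial

lemma gark_poly {m n : ℕ} (u c : Fin m → ℝ) (v d : Fin n → ℝ) (q : ℕ)
    (H : ∀ k : ℕ, 1 ≤ k → k ≤ q →
      (k : ℝ) * (u ⬝ᵥ fun i => c i ^ (k - 1)) = v ⬝ᵥ fun i => d i ^ k)
    (ψ : Polynomial ℝ) (hψ : ψ.natDegree ≤ q) :
    (u ⬝ᵥ fun i => (derivative ψ).eval (c i)) = v ⬝ᵥ fun i => (ψ.eval (d i) - ψ.eval 0) := by
  refine Polynomial.induction_with_natDegree_le
    (fun ψ => (u ⬝ᵥ fun i => (derivative ψ).eval (c i))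
      = v ⬝ᵥ fun i => (ψ.eval (d i) - ψ.eval 0)) q ?_ ?_ ?_ ψ hψ
  · simp [dotProduct]
  · intro k r hr hk
    rcases Nat.eq_zero_or_pos k with rfl | hk0
    · simp [dotProduct]
    · have := H k hk0 hk
      simp only [dotProduct] at this ⊢
      calc _ = r * (k * ∑ i, u i * c i ^ (k - 1)) := by
            simp only [Finset.mul_sum]
            refine Finset.sum_congr rfl fun i _ => ?_
            simp [derivative_X_pow]
            ring
        _ = _ := by
            rw [this, Finset.mul_sum]
            refine Finset.sum_congr rfl fun i _ => ?_
            simp [hk0.ne']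
            ring
  · intro f g hfg hg h1 h2
    simp only [dotProduct] at h1 h2 ⊢
    simp only [derivative_add, eval_add, mul_add, mul_sub, Finset.sum_add_distrib,
      Finset.sum_sub_distrib] at h1 h2 ⊢
    linarith

lemma gark_lim {n : ℕ} (A : Matrix (Fin n) (Fin n) ℝ) (hA : IsUnit A.det) :
    Tendsto (fun t : ℝ => (t • (1 : Matrix (Fin n) (Fin n) ℝ) - A)⁻¹) (𝓝 0) (𝓝 (-A⁻¹)) ∧
    ∀ᶠ t : ℝ in 𝓝 0, IsUnit (t • (1 : Matrix (Fin n) (Fin n) ℝ) - A).det := by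
  have hc : Continuous (fun t : ℝ => t • (1 : Matrix (Fin n) (Fin n) ℝ) - A) := by fun_prop
  have hd : Continuous (fun t : ℝ => (t • (1 : Matrix (Fin n) (Fin n) ℝ) - A).det) :=
    hc.matrix_det
  have h0 : ((0 : ℝ) • (1 : Matrix (Fin n) (Fin n) ℝ) - A).det ≠ 0 := by
    simp [det_neg, hA.ne_zero]
  constructor
  · have e : -A⁻¹ = ((0 : ℝ) • (1 : Matrix (Fin n) (Fin n) ℝ) - A)⁻¹ := by
      symm
      apply Matrix.inv_eq_left_inv
      simp [Matrix.nonsing_inv_mul A hA]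
    rw [e]
    simp only [Matrix.inv_def, Ring.inverse_eq_inv']
    exact ((hd.tendsto 0).inv₀ h0).smul (hc.matrix_adjugate.tendsto 0)
  · filter_upwards [hd.continuousAt.eventually_ne h0] with t ht
    exact isUnit_iff_ne_zero.mpr ht

/-- Prothero–Robinson stiff limit of an IMEX-GARK method: under the
explicit quadrature conditions and the additional stiff order conditions up to order `q`,
for a polynomial `φ` of degree at most `q` the global error recursion satisfies
`y_{n+1}(μ) − φ(t_n + h) → R_∞ (y_n − φ(t_n))` as `μ → −∞`, where
`R_∞ = 1 − (b^I)ᵀ (A^{II})⁻¹ 𝟙`. -/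
theorem imex_gark_prothero_robinson_limit
    (sE sI : ℕ)
    (AEE : Matrix (Fin sE) (Fin sE) ℝ)
    (AIE : Matrix (Fin sI) (Fin sE) ℝ)
    (AII : Matrix (Fin sI) (Fin sI) ℝ) (hAII : IsUnit AII.det)
    (bE : Fin sE → ℝ) (bI : Fin sI → ℝ)
    (cEE : Fin sE → ℝ) (hcEE : cEE = AEE *ᵥ fun _ => 1)
    (cIE : Fin sI → ℝ) (hcIE : cIE = AIE *ᵥ fun _ => 1)
    (q : ℕ) (hq : 1 ≤ q)
    (hquad : ∀ k : ℕ, 1 ≤ k → k ≤ q →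
      bE ⬝ᵥ (fun i => cEE i ^ (k - 1)) = 1 / (k : ℝ))
    (hstiff : ∀ k : ℕ, 1 ≤ k → k ≤ q →
      (k : ℝ) * (bI ⬝ᵥ ((AII⁻¹ * AIE) *ᵥ fun i => cEE i ^ (k - 1)))
        = bI ⬝ᵥ (AII⁻¹ *ᵥ fun i => cIE i ^ k))
    (φ : Polynomial ℝ) (hφ : φ.natDegree ≤ q)
    (h : ℝ) (hh : 0 < h) (tn yn : ℝ)
    (Z : ℝ → Fin sI → ℝ)
    (hZ : ∀ μ : ℝ, Z μ = (1 - (h * μ) • AII)⁻¹ *ᵥ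
      ((fun _ => yn)
        + h • (AIE *ᵥ fun i => (derivative φ).eval (tn + h * cEE i))
        - (h * μ) • (AII *ᵥ fun i => φ.eval (tn + h * cIE i))))
    (y1 : ℝ → ℝ)
    (hy1 : ∀ μ : ℝ, y1 μ = yn
      + h * (bE ⬝ᵥ fun i => (derivative φ).eval (tn + h * cEE i))
      + (h * μ) * (bI ⬝ᵥ (Z μ - fun i => φ.eval (tn + h * cIE i)))) :
    Tendsto (fun μ : ℝ => y1 μ - φ.eval (tn + h)) atBot
      (𝓝 ((1 - bI ⬝ᵥ (AII⁻¹ *ᵥ fun _ => 1)) * (yn - φ.eval tn))) := by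
  have quad := gark_poly bE cEE (fun _ : Fin 1 => (1 : ℝ)) (fun _ => 1) q (by
    intro k h1 h2
    rw [hquad k h1 h2]
    have : (k : ℝ) ≠ 0 := by positivity
    simp [dotProduct, this]) (φ.comp (C tn + C h * X))
  have stiff := gark_poly (bI ᵥ* (AII⁻¹ * AIE)) cEE (bI ᵥ* AII⁻¹) cIE q (by
    intro k h1 h2
    rw [← dotProduct_mulVec, ← dotProduct_mulVec]
    exact hstiff k h1 h2) (φ.comp (C tn + C h * X))
  have hdeg : (φ.comp (C tn + C h * X)).natDegree ≤ q := by
    refine natDegree_comp_le.trans ?_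
    have : (C tn + C h * X : Polynomial ℝ).natDegree ≤ 1 := by compute_degree
    nlinarith
  replace quad := quad hdeg
  replace stiff := stiff hdeg
  have hder : ∀ x, (derivative (φ.comp (C tn + C h * X))).eval x
      = h * (derivative φ).eval (tn + h * x) := by
    intro x
    simp [derivative_comp]
  have hev : ∀ x, (φ.comp (C tn + C h * X)).eval x = φ.eval (tn + h * x) := by
    intro x
    simp
  simp only [hder, hev, mul_zero, add_zero, mul_one] at quad stiff
  set f : Fin sE → ℝ := fun i => (derivative φ).eval (tn + h * cEE i) with hf
  set w : Fin sI → ℝ := fun i => φ.eval (tn + h * cIE i) with hw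
  have e1 : (fun i => h * eval (tn + h * cEE i) (derivative φ)) = h • f := rfl
  have e2 : (fun i => eval (tn + h * cIE i) φ - eval tn φ)
      = w - (φ.eval tn) • (fun _ => (1 : ℝ)) := by
    ext i; simp [hw]
  have e3 : (fun _ => yn : Fin sI → ℝ) = yn • (fun _ => (1 : ℝ)) := by
    ext i; simp
  rw [e1] at quad stiff
  rw [e2, ← dotProduct_mulVec, ← dotProduct_mulVec, ← mulVec_mulVec] at stiff
  simp only [dotProduct_smul, smul_eq_mul] at quad
  have quad' : h * (bE ⬝ᵥ f) = φ.eval (tn + h) - φ.eval tn := by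
    rw [quad]; simp [dotProduct]
  set g : Fin sI → ℝ := (fun _ => yn) + h • (AIE *ᵥ f) with hg
  obtain ⟨hl, hu⟩ := gark_lim AII hAII
  have ht : Tendsto (fun μ : ℝ => (h * μ)⁻¹) atBot (𝓝 0) :=
    tendsto_inv_atBot_zero.comp (tendsto_id.const_mul_atBot hh)
  have key : Tendsto (fun μ : ℝ => yn + (φ.eval (tn + h) - φ.eval tn)
      + bI ⬝ᵥ (((h * μ)⁻¹ • (1 : Matrix (Fin sI) (Fin sI) ℝ) - AII)⁻¹ *ᵥ (g - w))
      - φ.eval (tn + h)) atBot (𝓝 (yn + (φ.eval (tn + h) - φ.eval tn)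
      + bI ⬝ᵥ ((-AII⁻¹) *ᵥ (g - w)) - φ.eval (tn + h))) := by
    have hc : Continuous (fun B : Matrix (Fin sI) (Fin sI) ℝ =>
        yn + (φ.eval (tn + h) - φ.eval tn) + bI ⬝ᵥ (B *ᵥ (g - w)) - φ.eval (tn + h)) := by
      fun_prop
    exact (hc.tendsto _).comp (hl.comp ht)
  have lim_eq : yn + (φ.eval (tn + h) - φ.eval tn)
      + bI ⬝ᵥ ((-AII⁻¹) *ᵥ (g - w)) - φ.eval (tn + h)
      = (1 - bI ⬝ᵥ (AII⁻¹ *ᵥ fun _ => 1)) * (yn - φ.eval tn) := by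
    rw [hg, e3]
    simp only [neg_mulVec, mulVec_add, mulVec_sub, mulVec_smul, dotProduct_neg, dotProduct_add,
      dotProduct_sub, dotProduct_smul, smul_eq_mul] at stiff ⊢
    linarith
  rw [← lim_eq]
  refine key.congr' ?_
  filter_upwards [ht.eventually hu, eventually_lt_atBot (0 : ℝ)] with μ hμ hneg
  rw [hy1, hZ, quad']
  have hx : h * μ ≠ 0 := mul_ne_zero hh.ne' hneg.ne
  generalize h * μ = x at hμ hx
  set N := x⁻¹ • (1 : Matrix (Fin sI) (Fin sI) ℝ) - AII with hN
  have hM : 1 - x • AII = x • N := by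
    rw [hN, smul_sub, smul_smul, mul_inv_cancel₀ hx, one_smul]
  have hinv : (x • N)⁻¹ = x⁻¹ • N⁻¹ := by
    apply Matrix.inv_eq_left_inv
    rw [smul_mul_smul_comm, inv_mul_cancel₀ hx, Matrix.nonsing_inv_mul N hμ, one_smul]
  have hgw : g - x • (AII *ᵥ w) = (g - w) + (x • N) *ᵥ w := by
    rw [← hM, sub_mulVec, one_mulVec, smul_mulVec]
    abel
  have hZw : (1 - x • AII)⁻¹ *ᵥ (g - x • (AII *ᵥ w)) - w = x⁻¹ • (N⁻¹ *ᵥ (g - w)) := by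
    rw [hgw, hM, hinv, mulVec_add, mulVec_mulVec, smul_mul_smul_comm, inv_mul_cancel₀ hx,
      Matrix.nonsing_inv_mul N hμ, one_smul, one_mulVec, add_sub_cancel_right, smul_mulVec]
  rw [hZw, dotProduct_smul, smul_eq_mul, mul_inv_cancel_left₀ hx]
end

section
/- Let A^{II} ∈ ℝ^{s^{I}×s^{I}} be invertible, A^{IE} ∈ ℝ^{s^{I}×s^{E}}, A^{EE} ∈ ℝ^{s^{E}×s^{E}}, b^{I} ∈ ℝ^{s^{I}}, b^{E} ∈ ℝ^{s^{E}}, and let e ∈ ℝ^{s^{I}} be the last standard basis vector. Assume the stiff accuracy conditions eᵀ A^{IE} = (b^{E})ᵀ and eᵀ A^{II} = (b^{I})ᵀ. Set c^{EE} = A^{EE}𝟙 and c^{IE} = A^{IE}𝟙, and assume (b^{E})ᵀ (c^{EE})^{k−1} = 1/k for k = 1,…,q (powers componentwise; the case k = 1 reads (b^{E})ᵀ𝟙 = 1). Then for every k = 1,…,q, k (b^{I})ᵀ (A^{II})^{−1} A^{IE} (c^{EE})^{k−1} = (b^{I})ᵀ (A^{II})^{−1} (c^{IE})^{k}, and both sides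 equal 1. -/
open Matrix

/-- For a stiffly accurate IMEX-GARK method
(`e_sᵀ A^{IE} = (b^E)ᵀ`, `e_sᵀ A^{II} = (b^I)ᵀ`) whose explicit component satisfies the
quadrature conditions up to order `q`, the additional Prothero–Robinson order conditions
`k (b^I)ᵀ (A^{II})⁻¹ A^{IE} (c^{EE})^{k−1} = (b^I)ᵀ (A^{II})⁻¹ (c^{IE})^{k}` hold for
`k = 1,…,q`, and both sides equal `1`. -/
theorem stiffly_accurate_PR_order_conditions
    (sE nI : ℕ)
    (AEE : Matrix (Fin sE) (Fin sE) ℝ)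
    (AIE : Matrix (Fin (nI + 1)) (Fin sE) ℝ)
    (AII : Matrix (Fin (nI + 1)) (Fin (nI + 1)) ℝ) (hAII : IsUnit AII.det)
    (bE : Fin sE → ℝ) (bI : Fin (nI + 1) → ℝ)
    (e : Fin (nI + 1) → ℝ) (he : e = Pi.single (Fin.last nI) 1)
    (hsa1 : e ᵥ* AIE = bE) (hsa2 : e ᵥ* AII = bI)
    (cEE : Fin sE → ℝ) (hcEE : cEE = AEE *ᵥ fun _ => 1)
    (cIE : Fin (nI + 1) → ℝ) (hcIE : cIE = AIE *ᵥ fun _ => 1)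
    (q : ℕ)
    (hquad : ∀ k : ℕ, 1 ≤ k → k ≤ q →
      bE ⬝ᵥ (fun i => cEE i ^ (k - 1)) = 1 / (k : ℝ)) :
    ∀ k : ℕ, 1 ≤ k → k ≤ q →
      ((k : ℝ) * (bI ⬝ᵥ (AII⁻¹ *ᵥ (AIE *ᵥ fun i => cEE i ^ (k - 1))))
          = bI ⬝ᵥ (AII⁻¹ *ᵥ fun i => cIE i ^ k))
      ∧ (k : ℝ) * (bI ⬝ᵥ (AII⁻¹ *ᵥ (AIE *ᵥ fun i => cEE i ^ (k - 1)))) = 1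
      ∧ bI ⬝ᵥ (AII⁻¹ *ᵥ fun i => cIE i ^ k) = 1 := by
  intro k hk hkq
  have key : ∀ v : Fin (nI + 1) → ℝ, bI ⬝ᵥ (AII⁻¹ *ᵥ v) = e ⬝ᵥ v := by
    intro v
    rw [← hsa2, ← Matrix.dotProduct_mulVec, Matrix.mulVec_mulVec,
      Matrix.mul_nonsing_inv _ hAII, Matrix.one_mulVec]
  have hk0 : (k : ℝ) ≠ 0 := by
    have : k ≠ 0 := by omega
    exact_mod_cast this
  have h1 : (k : ℝ) * (bI ⬝ᵥ (AII⁻¹ *ᵥ (AIE *ᵥ fun i => cEE i ^ (k - 1)))) = 1 := by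
    rw [key, Matrix.dotProduct_mulVec, hsa1, hquad k hk hkq]
    field_simp
  have hc : cIE (Fin.last nI) = 1 := by
    have h := hquad 1 le_rfl (hk.trans hkq)
    have h2 : e ⬝ᵥ cIE = 1 := by
      rw [hcIE, Matrix.dotProduct_mulVec, hsa1]
      simpa using h
    simpa [he] using h2
  have h2 : bI ⬝ᵥ (AII⁻¹ *ᵥ fun i => cIE i ^ k) = 1 := by
    rw [key, he]
    simp [hc]
  exact ⟨h1.trans h2.symm, h1, h2⟩
end

section
/- Let A^{II} ∈ ℝ^{s^{I}×s^{I}} be invertible, A^{IE} ∈ ℝ^{s^{I}×s^{E}}, b^{I} ∈ ℝ^{s^{I}}, b^{E} ∈ ℝ^{s^{E}}, and let e ∈ ℝ^{s^{I}} be the last standard basis vector. Assume the stiff accuracy conditions eᵀ A^{IE} = (b^{E})ᵀ and eᵀ A^{II} = (b^{I})ᵀ, and assume (b^{I})ᵀ𝟙 = 1. Set c^{I} = A^{II}𝟙 and let c^{E} ∈ ℝ^{s^{E}} satisfy (b^{E})ᵀ (c^{E})^{k−1} = 1/k for k = 1,…,q (powers componentwise). Then for every k = 1,…,q: (b^{I})ᵀ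 (A^{II})^{−1} (c^{I})^{k} = 1 and (b^{I})ᵀ (A^{II})^{−1} A^{IE} (c^{E})^{k−1} = 1/k. -/
open Matrix

/-- For a stiffly accurate IMEX-GARK method
(`e_sᵀ A^{IE} = (b^E)ᵀ`, `e_sᵀ A^{II} = (b^I)ᵀ`, `(b^I)ᵀ𝟙 = 1`) whose explicit weights
satisfy the quadrature conditions up to order `q`, the additional semi-linear order
conditions `(b^I)ᵀ (A^{II})⁻¹ (c^I)^k = 1` and
`(b^I)ᵀ (A^{II})⁻¹ A^{IE} (c^E)^{k−1} = 1/k` hold for `k = 1,…,q`. -/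
theorem stiffly_accurate_SL_order_conditions
    (sE nI : ℕ)
    (AIE : Matrix (Fin (nI + 1)) (Fin sE) ℝ)
    (AII : Matrix (Fin (nI + 1)) (Fin (nI + 1)) ℝ) (hAII : IsUnit AII.det)
    (bE : Fin sE → ℝ) (bI : Fin (nI + 1) → ℝ)
    (e : Fin (nI + 1) → ℝ) (he : e = Pi.single (Fin.last nI) 1)
    (hsa1 : e ᵥ* AIE = bE) (hsa2 : e ᵥ* AII = bI)
    (hbI1 : bI ⬝ᵥ (fun _ => 1) = 1)
    (cI : Fin (nI + 1) → ℝ) (hcI : cI = AII *ᵥ fun _ => 1)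
    (cE : Fin sE → ℝ) (q : ℕ)
    (hquad : ∀ k : ℕ, 1 ≤ k → k ≤ q →
      bE ⬝ᵥ (fun i => cE i ^ (k - 1)) = 1 / (k : ℝ)) :
    ∀ k : ℕ, 1 ≤ k → k ≤ q →
      bI ⬝ᵥ (AII⁻¹ *ᵥ fun i => cI i ^ k) = 1
      ∧ bI ⬝ᵥ (AII⁻¹ *ᵥ (AIE *ᵥ fun i => cE i ^ (k - 1))) = 1 / (k : ℝ) := by
  have key : ∀ v : Fin (nI + 1) → ℝ, bI ⬝ᵥ (AII⁻¹ *ᵥ v) = e ⬝ᵥ v := by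
    intro v
    rw [← hsa2, ← Matrix.dotProduct_mulVec, Matrix.mulVec_mulVec,
      Matrix.mul_nonsing_inv _ hAII, Matrix.one_mulVec]
  intro k hk hkq
  refine ⟨?_, ?_⟩
  · have hc : cI (Fin.last nI) = 1 := by
      have h : e ⬝ᵥ cI = 1 := by
        rw [hcI, Matrix.dotProduct_mulVec, hsa2, hbI1]
      rw [he, single_one_dotProduct] at h
      exact h
    rw [key, he, single_one_dotProduct, hc, one_pow]
  · rw [key, Matrix.dotProduct_mulVec, hsa1]
    exact hquad k hk hkq
end

section
/- Let Â₁, Â₂ ∈ ℝ^{n×n}, let r₁, r₂ > 0, set S = I + r₁Â₁ + r₂Â₂, and assume S is invertible. Let Â ∈ ℝ^{2n×2n} be the block matrix [[Â₁, Â₂],[Â₁, Â₂]] and R̂ = diag(r₁I_n, r₂I_n). Then I + ÂR̂ is invertible and (I + ÂR̂)^{−1} Â R̂ = [[r₁S^{−1}Â₁, r₂S^{−1}Â₂],[r₁S^{−1}Â₁, r₂S^{−1}Â₂]]. Consequently, the absolute monotonicity conditions α(r) ≥ 0 and β(r) ≥ 0 for this GARK scheme hold if and only if S^{−1}𝟙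 ≥ 0, S^{−1}Â₁ ≥ 0, and S^{−1}Â₂ ≥ 0 (entrywise). -/
open Matrix

/-- For the block structure of a classical IMEX Runge-Kutta method,
`Â = [[Â₁, Â₂],[Â₁, Â₂]]` and `R̂ = diag(r₁I, r₂I)`, with `S = I + r₁Â₁ + r₂Â₂`
invertible, `I + ÂR̂` is invertible,
`β(r) = (I + ÂR̂)⁻¹ÂR̂ = [[r₁S⁻¹Â₁, r₂S⁻¹Â₂],[r₁S⁻¹Â₁, r₂S⁻¹Â₂]]`, and the absolute
monotonicity conditions `α(r) ≥ 0`, `β(r) ≥ 0` hold iff `S⁻¹𝟙 ≥ 0`, `S⁻¹Â₁ ≥ 0` and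
`S⁻¹Â₂ ≥ 0` entrywise. -/
theorem classical_imex_beta_blocks_and_monotonicity
    (n : ℕ) (A1 A2 : Matrix (Fin n) (Fin n) ℝ)
    (r1 r2 : ℝ) (hr1 : 0 < r1) (hr2 : 0 < r2)
    (S : Matrix (Fin n) (Fin n) ℝ) (hS : S = 1 + r1 • A1 + r2 • A2)
    (hSinv : IsUnit S.det)
    (Ahat : Matrix (Fin n ⊕ Fin n) (Fin n ⊕ Fin n) ℝ)
    (hAhat : Ahat = Matrix.fromBlocks A1 A2 A1 A2)
    (Rhat : Matrix (Fin n ⊕ Fin n) (Fin n ⊕ Fin n) ℝ)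
    (hRhat : Rhat = Matrix.fromBlocks (r1 • 1) 0 0 (r2 • 1)) :
    IsUnit (1 + Ahat * Rhat).det ∧
    (1 + Ahat * Rhat)⁻¹ * (Ahat * Rhat)
      = Matrix.fromBlocks (r1 • (S⁻¹ * A1)) (r2 • (S⁻¹ * A2))
          (r1 • (S⁻¹ * A1)) (r2 • (S⁻¹ * A2)) ∧
    (((∀ p, 0 ≤ ((1 + Ahat * Rhat)⁻¹ *ᵥ fun _ => (1 : ℝ)) p) ∧
        (∀ p q, 0 ≤ ((1 + Ahat * Rhat)⁻¹ * (Ahat * Rhat)) p q))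
      ↔ ((∀ i, 0 ≤ (S⁻¹ *ᵥ fun _ => (1 : ℝ)) i)
          ∧ (∀ i j, 0 ≤ (S⁻¹ * A1) i j)
          ∧ (∀ i j, 0 ≤ (S⁻¹ * A2) i j))) := by
  have hTS : S⁻¹ * S = 1 := Matrix.nonsing_inv_mul S hSinv
  have hST : S * S⁻¹ = 1 := Matrix.mul_nonsing_inv S hSinv
  have hM : Ahat * Rhat = Matrix.fromBlocks (r1 • A1) (r2 • A2) (r1 • A1) (r2 • A2) := by
    subst hAhat hRhat
    simp [Matrix.fromBlocks_multiply]
  generalize hT : S⁻¹ = T at *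
  set B : Matrix (Fin n ⊕ Fin n) (Fin n ⊕ Fin n) ℝ :=
    Matrix.fromBlocks (r1 • (T * A1)) (r2 • (T * A2)) (r1 • (T * A1)) (r2 • (T * A2)) with hB
  have key : ∀ Z : Matrix (Fin n) (Fin n) ℝ,
      (r1 • A1) * (T * Z) + (r2 • A2) * (T * Z) = Z - T * Z := by
    intro Z
    have h : S * T * Z = Z := by rw [hST, one_mul]
    have h2 : S * T * Z = T * Z + ((r1 • A1) * (T * Z) + (r2 • A2) * (T * Z)) := by
      rw [hS]
      noncomm_ring
    rw [h] at h2
    exact eq_sub_of_add_eq' h2.symm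
  have hMB : (Ahat * Rhat) * B = Ahat * Rhat - B := by
    have e : ∀ (r : ℝ) (Z : Matrix (Fin n) (Fin n) ℝ),
        (r1 • A1) * (r • (T * Z)) + (r2 • A2) * (r • (T * Z)) = r • Z - r • (T * Z) := by
      intro r Z
      have := key (r • Z)
      simpa only [Matrix.mul_smul] using this
    rw [hM, hB, Matrix.fromBlocks_multiply, e, e]
    simp only [sub_eq_add_neg, Matrix.fromBlocks_neg, Matrix.fromBlocks_add]
  have hinv : (1 + Ahat * Rhat) * (1 - B) = 1 := by
    rw [add_mul, mul_sub, mul_sub, hMB]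
    simp
  have hI : (1 + Ahat * Rhat)⁻¹ = 1 - B := Matrix.inv_eq_right_inv hinv
  have hU : IsUnit (1 + Ahat * Rhat).det := by
    have := congrArg Matrix.det hinv
    rw [Matrix.det_mul, Matrix.det_one] at this
    exact IsUnit.of_mul_eq_one _ this
  have hbeta : (1 + Ahat * Rhat)⁻¹ * (Ahat * Rhat) = B := by
    have h1 := Matrix.nonsing_inv_mul _ hU
    rw [mul_add, mul_one, ← eq_sub_iff_add_eq'] at h1
    rw [h1, hI, sub_sub_cancel]
  have hTs : r1 • (T * A1) + r2 • (T * A2) = 1 - T := by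
    have h2 : T * S = T + (r1 • (T * A1) + r2 • (T * A2)) := by
      rw [hS, mul_add, mul_add, mul_one, Matrix.mul_smul, Matrix.mul_smul, add_assoc]
    rw [hTS] at h2
    exact eq_sub_of_add_eq' h2.symm
  have hv : (r1 • (T * A1)) *ᵥ (fun _ => (1 : ℝ)) + (r2 • (T * A2)) *ᵥ (fun _ => (1 : ℝ))
      = (fun _ => (1 : ℝ)) - T *ᵥ (fun _ => (1 : ℝ)) := by
    rw [← Matrix.add_mulVec, hTs, Matrix.sub_mulVec, Matrix.one_mulVec]
  have halpha : (1 + Ahat * Rhat)⁻¹ *ᵥ (fun _ => (1 : ℝ))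
      = Sum.elim (T *ᵥ fun _ => (1 : ℝ)) (T *ᵥ fun _ => (1 : ℝ)) := by
    have hc1 : (fun _ : Fin n ⊕ Fin n => (1 : ℝ)) ∘ Sum.inl = fun _ => (1 : ℝ) := rfl
    have hc2 : (fun _ : Fin n ⊕ Fin n => (1 : ℝ)) ∘ Sum.inr = fun _ => (1 : ℝ) := rfl
    rw [hI, Matrix.sub_mulVec, Matrix.one_mulVec, hB, Matrix.fromBlocks_mulVec, hc1, hc2, hv]
    ext p
    rcases p with p | p <;> simp
  refine ⟨hU, hbeta, ?_⟩
  rw [hbeta, halpha]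
  constructor
  · rintro ⟨ha, hb⟩
    refine ⟨fun i => ha (Sum.inl i), fun i j => ?_, fun i j => ?_⟩
    · have h : 0 ≤ r1 * (T * A1) i j := hb (Sum.inl i) (Sum.inl j)
      exact nonneg_of_mul_nonneg_right h hr1
    · have h : 0 ≤ r2 * (T * A2) i j := hb (Sum.inl i) (Sum.inr j)
      exact nonneg_of_mul_nonneg_right h hr2
  · rintro ⟨ha, h1, h2⟩
    refine ⟨?_, ?_⟩
    · rintro (i | i)
      · exact ha i
      · exact ha i
    · rintro (i | i) (j | j)
      · exact mul_nonneg hr1.le (h1 i j)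
      · exact mul_nonneg hr2.le (h2 i j)
      · exact mul_nonneg hr1.le (h1 i j)
      · exact mul_nonneg hr2.le (h2 i j)
end

section
/- Let N, s, d be positive integers and let a^{q,m}_{ij} ∈ ℝ (1 ≤ q,m ≤ N, 1 ≤ i,j ≤ s) with a^{q,m}_{ij} = 0 whenever j ≥ i (explicit GARK), and b^{q} ∈ ℝ^{s}. Assume the order-two GARK conditions: Σ_{i=1}^{s} b^{q}_i = 1 for every q, and Σ_{i=1}^{s} Σ_{j=1}^{s} b^{q}_i a^{q,m}_{ij} = 1/2 for every q and m. Let f^{m} : ℝ^{d} → ℝ^{d} be twice continuously differentiable for each m, let t₀ ∈ ℝ, and let y : ℝ → ℝ^{d} satisfy y'(t) = Σ_{m=1}^{N} f^{m}(y(t)) for all t in a neighborhood of t₀. For h ≥ 0 define the stages recursively by Y^{q}_i(h) = y(t₀) + h Σ_{m=1}^{N} Σ_{j<i} a^{q,m}_{ij} f^{m}(Y^{m}_j(h)) and the numerical solution y₁(h) = y(t₀) + h Σ_{q=1}^{N} Σ_{i=1}^{s} b^{q}_i f^{q}(Y^{q}_i(h)). Then there exist C > 0 and h₀ > 0 such that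 ‖y₁(h) − y(t₀ + h)‖ ≤ C h³ for all h ∈ [0, h₀]. -/
open Filter Topology

open Asymptotics in
lemma gark_taylor_two {E : Type*} [NormedAddCommGroup E] [NormedSpace ℝ E] {F : E → E}
    (hF : ContDiff ℝ 2 F) (x₀ : E) :
    (fun x => F x - F x₀ - fderiv ℝ F x₀ (x - x₀)) =O[𝓝 x₀] (fun x => ‖x - x₀‖ ^ 2) := by
  have hd : Differentiable ℝ F := hF.differentiable (by norm_num)
  have h1 : ContDiff ℝ 1 (fderiv ℝ F) := hF.fderiv_right (by norm_num)
  have h2 := ((h1.differentiable (by norm_num)) x₀).isBigO_sub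
  obtain ⟨K, hK⟩ := h2.bound
  obtain ⟨r, hr, hball⟩ := Metric.eventually_nhds_iff_ball.1 hK
  refine IsBigO.of_bound K ?_
  filter_upwards [Metric.ball_mem_nhds x₀ hr] with x hx
  have hK0 : 0 ≤ K ∨ x = x₀ := by
    by_cases hxx : x = x₀
    · exact Or.inr hxx
    · left
      have := (norm_nonneg _).trans (hball x hx)
      have hp : 0 < ‖x - x₀‖ := norm_pos_iff.2 (sub_ne_zero.2 hxx)
      exact nonneg_of_mul_nonneg_left this hp
  rcases hK0 with hK0 | rfl
  · have := (convex_closedBall x₀ ‖x - x₀‖).norm_image_sub_le_of_norm_hasFDerivWithin_le'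
      (f := F) (f' := fderiv ℝ F) (φ := fderiv ℝ F x₀) (C := K * ‖x - x₀‖) (x := x₀) (y := x)
      (fun z _ => (hd z).hasFDerivAt.hasFDerivWithinAt)
      (fun z hz => by
        rw [mem_closedBall_iff_norm] at hz
        rw [mem_ball_iff_norm] at hx
        exact (hball z (mem_ball_iff_norm.2 (hz.trans_lt hx))).trans
          (mul_le_mul_of_nonneg_left hz hK0))
      (by simp) (by simp [dist_eq_norm])
    rw [norm_pow, norm_norm]
    linarith [this]
  · simp

open Asymptotics in
lemma gark_integrate {E : Type*} [NormedAddCommGroup E] [NormedSpace ℝ E] {u u' : ℝ → E}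
    (n : ℕ) (hu : ∀ᶠ t in 𝓝 (0 : ℝ), HasDerivAt u (u' t) t) (h0 : u 0 = 0)
    (hO : u' =O[𝓝 0] (fun t => t ^ n)) : u =O[𝓝 0] (fun t : ℝ => t ^ (n + 1)) := by
  obtain ⟨K, hKpos, hK⟩ := hO.exists_pos
  obtain ⟨r, hr, hball⟩ := Metric.eventually_nhds_iff_ball.1 (hu.and hK.bound)
  refine IsBigO.of_bound K ?_
  filter_upwards [Metric.ball_mem_nhds (0 : ℝ) hr] with x hx
  have hz : ∀ z ∈ Metric.closedBall (0 : ℝ) ‖x‖, z ∈ Metric.ball (0 : ℝ) r := fun z hz => by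
    rw [mem_closedBall_zero_iff] at hz
    rw [mem_ball_zero_iff] at hx ⊢
    exact hz.trans_lt hx
  have := (convex_closedBall (0 : ℝ) ‖x‖).norm_image_sub_le_of_norm_hasDerivWithin_le
      (f := u) (f' := u') (C := K * ‖x‖ ^ n) (x := 0) (y := x)
      (fun z h => (hball z (hz z h)).1.hasDerivWithinAt)
      (fun z h => by
        refine (hball z (hz z h)).2.trans ?_
        rw [mem_closedBall_zero_iff] at h
        rw [norm_pow]
        gcongr)
      (by simp) (by simp)
  rw [h0, sub_zero, sub_zero] at this
  rw [norm_pow, pow_succ]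
  linarith [this]

open Asymptotics in
lemma gark_wsum {ι E : Type*} [NormedAddCommGroup E] [NormedSpace ℝ E] (l : Filter ℝ)
    (s : Finset ι) (c : ι → ℝ) {F : ι → ℝ → E} {g : ℝ → ℝ} (hF : ∀ i ∈ s, F i =O[l] g) :
    (fun h => ∑ i ∈ s, c i • F i h) =O[l] g := by
  classical
  induction s using Finset.induction_on with
  | empty => simpa using isBigO_zero g l
  | insert i s hi ih =>
    simp only [Finset.sum_insert hi]
    have h1 : (fun h => c i • F i h) =O[l] g := (hF i (by simp)).const_smul_left (c i)
    exact h1.add (ih fun j hj => hF j (by simp [hj]))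

open Asymptotics in
lemma gark_wsum2 {ι κ E : Type*} [NormedAddCommGroup E] [NormedSpace ℝ E] (l : Filter ℝ)
    (t : Finset κ) (s : Finset ι) (c : κ → ι → ℝ) {F : κ → ι → ℝ → E} {g : ℝ → ℝ}
    (hF : ∀ k ∈ t, ∀ i ∈ s, F k i =O[l] g) :
    (fun h => ∑ k ∈ t, ∑ i ∈ s, c k i • F k i h) =O[l] g := by
  have := gark_wsum l t (fun _ => 1) (fun k hk => gark_wsum l s (c k) (hF k hk))
  simpa using this

open Asymptotics in
lemma gark_exact {E : Type*} [NormedAddCommGroup E] [NormedSpace ℝ E] {G : E → E}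
    (hG : ContDiff ℝ 2 G) {u : ℝ → E}
    (hu : ∀ᶠ t in 𝓝 (0 : ℝ), HasDerivAt u (G (u t)) t) :
    (fun h : ℝ => u h - u 0 - h • G (u 0) - (h ^ 2 / 2) • fderiv ℝ G (u 0) (G (u 0)))
      =O[𝓝 0] (fun h : ℝ => h ^ 3) := by
  have hu0 := hu.self_of_nhds
  have e1 : (fun h : ℝ => u h - u 0) =O[𝓝 0] (fun h : ℝ => h) := by
    simpa using hu0.differentiableAt.isBigO_sub
  have ht : Tendsto u (𝓝 0) (𝓝 (u 0)) := hu0.continuousAt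
  have hGd : Differentiable ℝ G := hG.differentiable (by norm_num)
  have e2 : (fun h : ℝ => G (u h) - G (u 0)) =O[𝓝 0] (fun h : ℝ => h) :=
    ((hGd (u 0)).isBigO_sub.comp_tendsto ht).trans e1
  have e3 : (fun h : ℝ => u h - u 0 - h • G (u 0)) =O[𝓝 0] (fun h : ℝ => h ^ 2) := by
    refine gark_integrate (u' := fun h => G (u h) - G (u 0)) 1 ?_ (by simp) (by simpa using e2)
    filter_upwards [hu] with t h
    simpa using (h.sub_const (u 0)).fun_sub ((hasDerivAt_id' t).smul_const (G (u 0)))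
  refine gark_integrate (u' := fun h => G (u h) - G (u 0) - h • fderiv ℝ G (u 0) (G (u 0)))
    2 ?_ (by simp) ?_
  · filter_upwards [hu] with t h
    have h2 : HasDerivAt (fun h : ℝ => h ^ 2 / 2) t t := by
      have := ((hasDerivAt_id' t).fun_pow 2).div_const 2
      simpa using this
    have h3 := ((h.sub_const (u 0)).fun_sub ((hasDerivAt_id' t).smul_const (G (u 0)))).fun_sub
      (h2.smul_const (fderiv ℝ G (u 0) (G (u 0))))
    simpa using h3
  · have e4 : (fun h : ℝ => G (u h) - G (u 0) - fderiv ℝ G (u 0) (u h - u 0))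
        =O[𝓝 0] (fun h : ℝ => h ^ 2) :=
      ((gark_taylor_two hG (u 0)).comp_tendsto ht).trans (e1.norm_left.pow 2)
    have e5 := ((fderiv ℝ G (u 0)).isBigO_comp (fun h : ℝ => u h - u 0 - h • G (u 0)) (𝓝 0)).trans e3
    refine (e4.add e5).congr_left fun h => ?_
    simp only [map_sub, map_smul]
    abel

open Asymptotics in
/-- An explicit GARK method satisfying the order conditions of orders
one and two produces, for twice continuously differentiable right hand side components,
a one-step numerical solution whose local error is `O(h³)`. -/
theorem gark_explicit_order_two_local_error
    (N s d : ℕ) (hN : 0 < N) (hs : 0 < s) (hd : 0 < d)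
    (a : Fin N → Fin N → Fin s → Fin s → ℝ)
    (haexp : ∀ q m i j, i ≤ j → a q m i j = 0)
    (b : Fin N → Fin s → ℝ)
    (hb1 : ∀ q, ∑ i, b q i = 1)
    (hb2 : ∀ q m, ∑ i, ∑ j, b q i * a q m i j = 1 / 2)
    (f : Fin N → EuclideanSpace ℝ (Fin d) → EuclideanSpace ℝ (Fin d))
    (hf : ∀ m, ContDiff ℝ 2 (f m))
    (t₀ : ℝ) (y : ℝ → EuclideanSpace ℝ (Fin d))
    (hy : ∀ᶠ t in 𝓝 t₀, HasDerivAt y (∑ m, f m (y t)) t)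
    (Y : ℝ → Fin N → Fin s → EuclideanSpace ℝ (Fin d))
    (hY : ∀ h : ℝ, 0 ≤ h → ∀ q i,
      Y h q i = y t₀ + h • ∑ m, ∑ j ∈ Finset.Iio i, a q m i j • f m (Y h m j))
    (y1 : ℝ → EuclideanSpace ℝ (Fin d))
    (hy1 : ∀ h : ℝ, 0 ≤ h → y1 h = y t₀ + h • ∑ q, ∑ i, b q i • f q (Y h q i)) :
    ∃ C > 0, ∃ h₀ > 0, ∀ h : ℝ, 0 ≤ h → h ≤ h₀ →
      ‖y1 h - y (t₀ + h)‖ ≤ C * h ^ 3 := by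
  classical
  set l : Filter ℝ := 𝓝[≥] (0 : ℝ) with hl
  have hl0 : l ≤ 𝓝 0 := nhdsWithin_le_nhds
  have hge : ∀ᶠ h : ℝ in l, 0 ≤ h := self_mem_nhdsWithin
  have hid : Tendsto (fun h : ℝ => h) l (𝓝 0) := hl0
  have hfd : ∀ m, Differentiable ℝ (f m) := fun m => (hf m).differentiable (by norm_num)
  -- the stages are close to the initial value
  have st1 : ∀ i q, (fun h => Y h q i - y t₀) =O[l] (fun h : ℝ => h) := by
    intro i
    induction i using WellFoundedLT.induction with
    | ind i ih =>
      intro q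
      have hb : (fun h => ∑ m, ∑ j ∈ Finset.Iio i, a q m i j • f m (Y h m j))
          =O[l] (fun _ : ℝ => (1 : ℝ)) := by
        refine gark_wsum2 l _ _ (fun m j => a q m i j) (F := fun m j h => f m (Y h m j)) fun m _ j hj => ?_
        have ht : Tendsto (fun h => Y h m j) l (𝓝 (y t₀)) :=
          tendsto_sub_nhds_zero_iff.1 ((ih j (Finset.mem_Iio.1 hj) m).trans_tendsto hid)
        exact (((hfd m).continuous.tendsto _).comp ht).isBigO_one ℝ
      have := (isBigO_refl (fun h : ℝ => h) l).smul hb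
      refine this.congr' ?_ (by simp)
      filter_upwards [hge] with h hh
      rw [hY h hh q i]
      simp
  have stt : ∀ i q, Tendsto (fun h => Y h q i) l (𝓝 (y t₀)) := fun i q =>
    tendsto_sub_nhds_zero_iff.1 ((st1 i q).trans_tendsto hid)
  have st2 : ∀ i q, (fun h => f q (Y h q i) - f q (y t₀)) =O[l] (fun h : ℝ => h) := fun i q =>
    ((hfd q (y t₀)).isBigO_sub.comp_tendsto (stt i q)).trans (st1 i q)
  have hYfull : ∀ h : ℝ, 0 ≤ h → ∀ q i,
      Y h q i = y t₀ + h • ∑ m, ∑ j, a q m i j • f m (Y h m j) := by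
    intro h hh q i
    rw [hY h hh q i]
    congr 2
    refine Finset.sum_congr rfl fun m _ => Finset.sum_subset (Finset.subset_univ _) ?_
    intro j _ hj
    rw [haexp q m i j (by simpa using hj), zero_smul]
  have st3 : ∀ i q, (fun h => Y h q i - y t₀ - h • ∑ m, ∑ j, a q m i j • f m (y t₀))
      =O[l] (fun h : ℝ => h ^ 2) := by
    intro i q
    have hb : (fun h => ∑ m, ∑ j, a q m i j • (f m (Y h m j) - f m (y t₀)))
          =O[l] (fun h : ℝ => h) :=
      gark_wsum2 l _ _ (fun m j => a q m i j) fun m _ j _ => st2 j m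
    have := (isBigO_refl (fun h : ℝ => h) l).smul hb
    refine this.congr' ?_ (by simp [pow_two])
    filter_upwards [hge] with h hh
    rw [hYfull h hh q i]
    simp only [smul_sub, Finset.sum_sub_distrib]
    abel
  have st4 : ∀ i q, (fun h => f q (Y h q i) - f q (y t₀)
      - h • fderiv ℝ (f q) (y t₀) (∑ m, ∑ j, a q m i j • f m (y t₀)))
      =O[l] (fun h : ℝ => h ^ 2) := by
    intro i q
    have e4 := ((gark_taylor_two (hf q) (y t₀)).comp_tendsto (stt i q)).trans
      ((st1 i q).norm_left.pow 2)
    have e5 := ((fderiv ℝ (f q) (y t₀)).isBigO_comp _ l).trans (st3 i q)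
    refine (e4.add e5).congr_left fun h => ?_
    simp only [map_sub, map_smul, Function.comp]
    abel
  have st5 : (fun h => h • ∑ q, ∑ i, b q i • (f q (Y h q i) - f q (y t₀)
      - h • fderiv ℝ (f q) (y t₀) (∑ m, ∑ j, a q m i j • f m (y t₀))))
      =O[l] (fun h : ℝ => h ^ 3) := by
    have hb := gark_wsum2 l Finset.univ Finset.univ (fun q i => b q i) fun q _ i _ => st4 i q
    refine ((isBigO_refl (fun h : ℝ => h) l).smul hb).congr_right fun h => ?_
    simp only [smul_eq_mul]
    ring
  -- the exact solution
  have hG : ContDiff ℝ 2 (fun x => ∑ m, f m x) := ContDiff.sum fun m _ => hf m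
  have hu : ∀ᶠ t in 𝓝 (0 : ℝ), HasDerivAt (fun h => y (t₀ + h)) (∑ m, f m (y (t₀ + t))) t := by
    have ht : Tendsto (fun h : ℝ => t₀ + h) (𝓝 0) (𝓝 t₀) := by
      have : Continuous (fun h : ℝ => t₀ + h) := by fun_prop
      simpa using this.tendsto 0
    filter_upwards [ht.eventually hy] with t h
    exact h.comp_const_add t₀ t
  have ex := (gark_exact (u := fun h => y (t₀ + h)) hG hu).mono hl0
  have hfds : fderiv ℝ (fun x => ∑ m, f m x) (y t₀) = ∑ m, fderiv ℝ (f m) (y t₀) :=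
    fderiv_fun_sum fun m _ => hfd m _
  simp only [add_zero, hfds] at ex
  -- order conditions
  have oc1 : ∑ q, ∑ i, b q i • f q (y t₀) = ∑ q, f q (y t₀) := by
    refine Finset.sum_congr rfl fun q _ => ?_
    rw [← Finset.sum_smul, hb1, one_smul]
  have oc2 : ∑ q, ∑ i, b q i • fderiv ℝ (f q) (y t₀) (∑ m, ∑ j, a q m i j • f m (y t₀))
      = (1 / 2 : ℝ) • (∑ q, fderiv ℝ (f q) (y t₀)) (∑ m, f m (y t₀)) := by
    rw [_root_.sum_apply, Finset.smul_sum]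
    refine Finset.sum_congr rfl fun q _ => ?_
    simp only [← map_smul, ← map_sum]
    congr 1
    simp only [Finset.smul_sum, smul_smul]
    rw [Finset.sum_comm]
    refine Finset.sum_congr rfl fun m _ => ?_
    simp only [← Finset.sum_smul]
    rw [hb2]
  have fin : (fun h => y1 h - y (t₀ + h)) =O[l] (fun h : ℝ => h ^ 3) := by
    refine (st5.sub ex).congr' ?_ (by rfl)
    filter_upwards [hge] with h hh
    rw [hy1 h hh]
    simp only [smul_sub, Finset.sum_sub_distrib, oc1]
    have hc : ∀ q i, b q i • h • fderiv ℝ (f q) (y t₀) (∑ m, ∑ j, a q m i j • f m (y t₀))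
        = h • b q i • fderiv ℝ (f q) (y t₀) (∑ m, ∑ j, a q m i j • f m (y t₀)) :=
      fun q i => smul_comm _ _ _
    simp only [hc]
    simp only [← Finset.smul_sum]
    simp only [oc2]
    module
  obtain ⟨C, hC, hb⟩ := fin.exists_pos
  obtain ⟨r, hr, hball⟩ := Metric.mem_nhdsWithin_iff.1 hb.bound
  refine ⟨C, hC, r / 2, by positivity, fun h h0 h1 => ?_⟩
  have := hball (a := h) ⟨by rw [mem_ball_zero_iff, Real.norm_of_nonneg h0]; linarith, h0⟩
  simpa [abs_of_nonneg h0] using this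
end

section
/- Let N, s, d be positive integers and let a^{q,m}_{ij} ∈ ℝ (1 ≤ q,m ≤ N, 1 ≤ i,j ≤ s) with a^{q,m}_{ij} = 0 whenever j ≥ i (explicit GARK), and b^{q} ∈ ℝ^{s}. Assume the GARK order conditions up to order three: Σ_i b^{σ}_i = 1 for all σ; Σ_{i,j} b^{σ}_i a^{σ,ν}_{ij} = 1/2 for all σ, ν; Σ_{i,j,k} b^{σ}_i a^{σ,ν}_{ij} a^{σ,μ}_{ik} = 1/3 for all σ, ν, μ; and Σ_{i,j,k} b^{σ}_i a^{σ,ν}_{ij} a^{ν,μ}_{jk} = 1/6 for all σ, ν, μ. Let f^{m} : ℝ^{d} → ℝ^{d} be three times continuously differentiable for each m, let t₀ ∈ ℝ, and let y : ℝ → ℝ^{d} satisfy y'(t) = Σ_{m=1}^{N} f^{m}(y(t)) for all t in a neighborhood of t₀. For h ≥ 0 define the stages recursively by Y^{q}_i(h) = y(t₀) + h Σ_{m=1}^{N} Σ_{j<i} a^{q,m}_{ij} f^{m}(Y^{m}_j(h)) and the numerical solution y₁(h) = y(t₀) + h Σ_{q=1}^{N} Σ_{i=1}^{s} b^{q}_i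 f^{q}(Y^{q}_i(h)). Then there exist C > 0 and h₀ > 0 such that ‖y₁(h) − y(t₀ + h)‖ ≤ C h⁴ for all h ∈ [0, h₀]. -/
open Filter Topology

section helpers
open Asymptotics

variable {E : Type*} [NormedAddCommGroup E] [NormedSpace ℝ E]
variable {G : Type*} [NormedAddCommGroup G] [NormedSpace ℝ G]

lemma gark_isBigO_integrate (g : G → E) (g' : G → G →L[ℝ] E) (n : ℕ)
    (hg : ∀ᶠ u in 𝓝 (0 : G), HasFDerivAt g (g' u) u)
    (hO : g' =O[𝓝 0] (fun u : G => ‖u‖ ^ n)) (h0 : g 0 = 0) :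
    g =O[𝓝 0] (fun u : G => ‖u‖ ^ (n + 1)) := by
  obtain ⟨C, hC0, hC⟩ := hO.exists_nonneg
  rw [IsBigOWith] at hC
  obtain ⟨r, hr, hball⟩ := Metric.eventually_nhds_iff_ball.1 (hg.and hC)
  refine IsBigO.of_bound C ?_
  filter_upwards [Metric.ball_mem_nhds (0 : G) hr] with u hu
  have hsub : Metric.closedBall (0 : G) ‖u‖ ⊆ Metric.ball 0 r := by
    apply Metric.closedBall_subset_ball
    simpa using hu
  have := (convex_closedBall (0 : G) ‖u‖).norm_image_sub_le_of_norm_hasFDerivWithin_le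
    (f := g) (f' := g') (C := C * ‖u‖ ^ n) (x := 0) (y := u)
    (fun x hx => (hball x (hsub hx)).1.hasFDerivWithinAt)
    (fun x hx => by
      refine (hball x (hsub hx)).2.trans ?_
      have hx' : ‖x‖ ≤ ‖u‖ := by simpa using hx
      rw [norm_pow, norm_norm]
      gcongr) (by simp) (by simp)
  rw [h0, sub_zero, sub_zero] at this
  rw [norm_pow, norm_norm, pow_succ, ← mul_assoc]
  exact this

lemma gark_isBigO_integrate_real (g g' : ℝ → E) (n : ℕ)
    (hg : ∀ᶠ u in 𝓝 (0 : ℝ), HasDerivAt g (g' u) u)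
    (hO : g' =O[𝓝 0] (fun u : ℝ => u ^ n)) (h0 : g 0 = 0) :
    g =O[𝓝 0] (fun u : ℝ => u ^ (n + 1)) := by
  have := gark_isBigO_integrate g (fun u => ContinuousLinearMap.toSpanSingleton ℝ (g' u)) n
    (hg.mono fun u hu => hu.hasFDerivAt) ?_ h0
  · refine this.trans (IsBigO.of_bound 1 (Eventually.of_forall fun u => ?_))
    simp
  · refine IsBigO.trans (IsBigO.of_bound 1 (Eventually.of_forall fun u => ?_))
      (hO.trans (IsBigO.of_bound 1 (Eventually.of_forall fun u => ?_)))
    · simp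
    · simp

lemma gark_taylor (f : E → E) (hf : ContDiff ℝ 3 f) (x : E) :
    ∃ (L : E →L[ℝ] E) (B : E →L[ℝ] E →L[ℝ] E),
      (fun u => f (x + u) - f x - L u - (1 / 2 : ℝ) • B u u) =O[𝓝 0]
        (fun u : E => ‖u‖ ^ 3) := by
  have hf1 : ContDiff ℝ 2 (fderiv ℝ f) := hf.fderiv_right (by norm_num)
  have hf2 : ContDiff ℝ 1 (fderiv ℝ (fderiv ℝ f)) := hf1.fderiv_right (by norm_num)
  set D1 := fderiv ℝ f with hD1
  set D2 := fderiv ℝ D1 with hD2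
  have h1 : ∀ z, HasFDerivAt f (D1 z) z := fun z =>
    (hf.differentiable (by norm_num) z).hasFDerivAt
  have h2 : ∀ z, HasFDerivAt D1 (D2 z) z := fun z =>
    (hf1.differentiable (by norm_num) z).hasFDerivAt
  have hsymm : ∀ v w, D2 x v w = D2 x w v := fun v w =>
    second_derivative_symmetric h1 (h2 x) v w
  have hadd : Tendsto (fun u : E => x + u) (𝓝 0) (𝓝 x) := by
    have : Continuous (fun u : E => x + u) := by fun_prop
    simpa using this.tendsto 0
  have s1 : (fun u : E => D2 (x + u) - D2 x) =O[𝓝 0] (fun u : E => ‖u‖ ^ 1) := by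
    have := ((hf2.differentiable (by norm_num) x).isBigO_sub).comp_tendsto hadd
    simpa [Function.comp_def] using this.norm_right
  have shift : ∀ u : E, HasFDerivAt (fun u : E => x + u) (ContinuousLinearMap.id ℝ E) u :=
    fun u => (hasFDerivAt_id u).const_add x
  have s2 := gark_isBigO_integrate (fun u : E => D1 (x + u) - D1 x - D2 x u)
    (fun u : E => D2 (x + u) - D2 x) 1 (Eventually.of_forall fun u => by
      have := (((h2 (x + u)).comp u (shift u)).sub_const (D1 x)).sub ((D2 x).hasFDerivAt (x := u))
      refine this.congr_fderiv ?_
      simp) s1 (by simp)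
  have s3 := gark_isBigO_integrate
    (fun u : E => f (x + u) - f x - D1 x u - (1 / 2 : ℝ) • D2 x u u)
    (fun u : E => D1 (x + u) - D1 x - D2 x u) 2 (Eventually.of_forall fun u => by
      have hb : HasFDerivAt (fun u : E => D2 x u u) ((2 : ℝ) • D2 x u) u := by
        have := (D2 x).hasFDerivAt_of_bilinear (hasFDerivAt_id u) (hasFDerivAt_id u)
        refine this.congr_fderiv ?_
        ext w
        simp [hsymm w u, two_smul]
      have := ((((h1 (x + u)).comp u (shift u)).sub_const (f x)).sub
        ((D1 x).hasFDerivAt (x := u))).sub (hb.const_smul (1 / 2 : ℝ))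
      refine this.congr_fderiv ?_
      ext w
      simp [smul_smul]) s2 (by simp)
  exact ⟨D1 x, D2 x, s3⟩

/-- The Taylor property used below. -/
def GarkTaylor (f : E → E) (x : E) (L : E →L[ℝ] E) (B : E →L[ℝ] E →L[ℝ] E) : Prop :=
  (fun u => f (x + u) - f x - L u - (1 / 2 : ℝ) • B u u) =O[𝓝 0] (fun u : E => ‖u‖ ^ 3)

variable {l : Filter ℝ}

lemma gark_pow_le (hl : l ≤ 𝓝 0) {m n : ℕ} (h : m ≤ n) :
    (fun h : ℝ => h ^ n) =O[l] (fun h : ℝ => h ^ m) := by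
  obtain ⟨k, rfl⟩ := Nat.exists_eq_add_of_le h
  have : (fun h : ℝ => h ^ k) =O[l] (fun _ => (1 : ℝ)) :=
    (((continuous_pow k).tendsto (0 : ℝ)).isBigO_one ℝ).mono hl
  simpa [pow_add] using (isBigO_refl (fun h : ℝ => h ^ m) l).mul this

lemma gark_pow_smul (hl : l ≤ 𝓝 0) {m n : ℕ} (h : m ≤ n) (v : E) :
    (fun h : ℝ => h ^ n • v) =O[l] (fun h : ℝ => h ^ m) := by
  have := (gark_pow_le hl h).smul (isBigO_refl (fun _ => v) l)
  refine this.trans (IsBigO.of_bound ‖v‖ (Eventually.of_forall fun u => ?_))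
  rw [norm_smul, mul_comm]

lemma gark_expand_base {f : E → E} {x : E} {L : E →L[ℝ] E} {B : E →L[ℝ] E →L[ℝ] E}
    (hT : GarkTaylor f x L B) (hl : l ≤ 𝓝 0) {u : ℝ → E}
    (hu : u =O[l] (fun h : ℝ => h ^ 1)) :
    (fun h => f (x + u h) - f x - L (u h) - (1 / 2 : ℝ) • B (u h) (u h)) =O[l]
      (fun h : ℝ => h ^ 3) := by
  have ht : Tendsto u l (𝓝 0) := by
    refine hu.trans_tendsto ?_
    simp only [pow_one]
    exact hl
  have := hT.comp_tendsto ht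
  refine this.trans ?_
  simpa [Function.comp_def] using hu.norm_left.pow 3

lemma gark_bilin (B : E →L[ℝ] E →L[ℝ] E) {u v : ℝ → E} {m n : ℕ}
    (hu : u =O[l] (fun h : ℝ => h ^ m)) (hv : v =O[l] (fun h : ℝ => h ^ n)) :
    (fun h => B (u h) (v h)) =O[l] (fun h : ℝ => h ^ (m + n)) := by
  have h1 : (fun h => B (u h) (v h)) =O[l] (fun h => ‖u h‖ * ‖v h‖) := by
    refine IsBigO.of_bound ‖B‖ (Eventually.of_forall fun h => ?_)
    have := B.le_opNorm₂ (u h) (v h)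
    simpa [mul_assoc] using this
  refine h1.trans ?_
  simpa [pow_add] using hu.norm_left.mul hv.norm_left

lemma gark_lin (L : E →L[ℝ] E) {u : ℝ → E} {m : ℕ}
    (hu : u =O[l] (fun h : ℝ => h ^ m)) :
    (fun h => L (u h)) =O[l] (fun h : ℝ => h ^ m) :=
  (L.isBigO_comp u l).trans hu

lemma gark_expand1 {f : E → E} {x : E} {L : E →L[ℝ] E} {B : E →L[ℝ] E →L[ℝ] E}
    (hT : GarkTaylor f x L B) (hl : l ≤ 𝓝 0) {u : ℝ → E}
    (hu : u =O[l] (fun h : ℝ => h ^ 1)) :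
    (fun h => f (x + u h) - f x) =O[l] (fun h : ℝ => h ^ 1) := by
  have h3 := (gark_expand_base hT hl hu).trans (gark_pow_le hl (show 1 ≤ 3 by norm_num))
  have hB := ((gark_bilin B hu hu).const_smul_left (1 / 2 : ℝ)).trans
    (gark_pow_le hl (show 1 ≤ 1 + 1 by norm_num))
  refine ((h3.add hB).add (gark_lin L hu)).congr_left fun h => ?_
  simp

lemma gark_expand2 {f : E → E} {x : E} {L : E →L[ℝ] E} {B : E →L[ℝ] E →L[ℝ] E}
    (hT : GarkTaylor f x L B) (hl : l ≤ 𝓝 0) {u : ℝ → E} {v : E}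
    (hu : (fun h => u h - h • v) =O[l] (fun h : ℝ => h ^ 2)) :
    (fun h => f (x + u h) - (f x + h • L v)) =O[l] (fun h : ℝ => h ^ 2) := by
  have hu1 : u =O[l] (fun h : ℝ => h ^ 1) := by
    refine ((hu.trans (gark_pow_le hl (show 1 ≤ 2 by norm_num))).add
      (gark_pow_smul hl (le_refl 1) v)).congr_left fun h => ?_
    simp
  have h3 := (gark_expand_base hT hl hu1).trans (gark_pow_le hl (show 2 ≤ 3 by norm_num))
  have hB := ((gark_bilin B hu1 hu1).const_smul_left (1 / 2 : ℝ))
  refine ((h3.add hB).add (gark_lin L hu)).congr_left fun h => ?_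
  simp only [map_sub, map_smul, Pi.smul_apply]
  abel

lemma gark_expand3 {f : E → E} {x : E} {L : E →L[ℝ] E} {B : E →L[ℝ] E →L[ℝ] E}
    (hT : GarkTaylor f x L B) (hl : l ≤ 𝓝 0) {u : ℝ → E} {v w : E}
    (hu : (fun h => u h - (h • v + h ^ 2 • w)) =O[l] (fun h : ℝ => h ^ 3)) :
    (fun h => f (x + u h) - (f x + h • L v + h ^ 2 • (L w + (1 / 2 : ℝ) • B v v))) =O[l]
      (fun h : ℝ => h ^ 3) := by
  have hu2 : (fun h => u h - h • v) =O[l] (fun h : ℝ => h ^ 2) := by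
    refine ((hu.trans (gark_pow_le hl (show 2 ≤ 3 by norm_num))).add
      (gark_pow_smul hl (le_refl 2) w)).congr_left fun h => ?_
    abel
  have hv1 : (fun h : ℝ => h • v) =O[l] (fun h : ℝ => h ^ 1) := by
    simpa using gark_pow_smul hl (le_refl 1) v
  have hu1 : u =O[l] (fun h : ℝ => h ^ 1) := by
    refine ((hu2.trans (gark_pow_le hl (show 1 ≤ 2 by norm_num))).add hv1).congr_left fun h => ?_
    simp
  have h3 := gark_expand_base hT hl hu1
  have hB1 := ((gark_bilin B hu2 hu1).const_smul_left (1 / 2 : ℝ))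
  have hB2 := ((gark_bilin B hv1 hu2).const_smul_left (1 / 2 : ℝ))
  refine (((h3.add hB1).add hB2).add (gark_lin L hu)).congr_left fun h => ?_
  simp only [map_sub, map_add, map_smul, Pi.smul_apply, ContinuousLinearMap.sub_apply,
    ContinuousLinearMap.smul_apply]
  module

/-- Multiplying an expansion of the slopes by `h`. -/
lemma gark_step {N s : ℕ} (c : Fin N → Fin s → ℝ) (K P : ℝ → Fin N → Fin s → E) (n : ℕ)
    (hK : ∀ m j, c m j ≠ 0 → (fun h => K h m j - P h m j) =O[l] (fun h : ℝ => h ^ n)) :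
    (fun h => h • ∑ m, ∑ j, c m j • K h m j - h • ∑ m, ∑ j, c m j • P h m j) =O[l]
      (fun h : ℝ => h ^ (n + 1)) := by
  have h1 : (fun h => ∑ m, ∑ j, c m j • (K h m j - P h m j)) =O[l] (fun h : ℝ => h ^ n) := by
    refine IsBigO.fun_sum fun m _ => IsBigO.fun_sum fun j _ => ?_
    by_cases hc : c m j = 0
    · simp only [hc, zero_smul]
      exact isBigO_zero _ _
    · exact (hK m j hc).const_smul_left (c m j)
  refine ((isBigO_refl (fun h : ℝ => h) l).smul h1).congr (fun h => ?_) (fun h => ?_)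
  · simp only [smul_sub, Finset.sum_sub_distrib]
  · rw [smul_eq_mul, pow_succ']

lemma gark_exact_s17 {N : ℕ} (f : Fin N → E → E) (x : E) (L : Fin N → E →L[ℝ] E)
    (B : Fin N → E →L[ℝ] E →L[ℝ] E) (hT : ∀ m, GarkTaylor (f m) x (L m) (B m))
    (u : ℝ → E) (hu0 : u 0 = 0)
    (hu : ∀ᶠ h in 𝓝 (0 : ℝ), HasDerivAt u (∑ m, f m (x + u h)) h) :
    (fun h => u h - (h • (∑ m, f m x) + h ^ 2 • ((1 / 2 : ℝ) • ∑ m, L m (∑ r, f r x)) +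
      h ^ 3 • ((1 / 6 : ℝ) • ∑ m, (L m (∑ r, L r (∑ k, f k x)) +
        B m (∑ r, f r x) (∑ r, f r x))))) =O[𝓝 0] (fun h : ℝ => h ^ 4) := by
  set F0 := ∑ m, f m x with hF0
  set F1 := ∑ m, L m F0 with hF1
  have e0 : u =O[𝓝 0] (fun h : ℝ => h ^ 1) := by
    have := (hu.self_of_nhds.differentiableAt).isBigO_sub
    simpa [hu0] using this
  have e1 : (fun h => u h - h • F0) =O[𝓝 0] (fun h : ℝ => h ^ 2) := by
    refine gark_isBigO_integrate_real _ (fun h => ∑ m, f m (x + u h) - F0) 1 ?_ ?_ (by simp [hu0])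
    · filter_upwards [hu] with h hh
      have := hh.sub ((hasDerivAt_id h).smul_const F0)
      refine this.congr_deriv ?_
      simp
    · simp only [hF0, ← Finset.sum_sub_distrib]
      exact IsBigO.fun_sum fun m _ => gark_expand1 (hT m) le_rfl e0
  have e2 : (fun h => u h - (h • F0 + h ^ 2 • ((1 / 2 : ℝ) • F1))) =O[𝓝 0]
      (fun h : ℝ => h ^ 3) := by
    refine gark_isBigO_integrate_real _ (fun h => ∑ m, f m (x + u h) - (F0 + h • F1)) 2 ?_ ?_
      (by simp [hu0])
    · filter_upwards [hu] with h hh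
      have := hh.sub (((hasDerivAt_id h).smul_const F0).add
        ((hasDerivAt_pow 2 h).smul_const ((1 / 2 : ℝ) • F1)))
      refine this.congr_deriv ?_
      push_cast
      module
    · have : (fun h => ∑ m, (f m (x + u h) - (f m x + h • L m F0))) =O[𝓝 0]
          (fun h : ℝ => h ^ 2) :=
        IsBigO.fun_sum fun m _ => gark_expand2 (hT m) le_rfl e1
      refine this.congr_left fun h => ?_
      rw [Finset.sum_sub_distrib, Finset.sum_add_distrib, ← Finset.smul_sum]
  refine gark_isBigO_integrate_real _ (fun h => ∑ m, f m (x + u h) - (F0 + h • F1 +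
    h ^ 2 • ((1 / 2 : ℝ) • ∑ m, (L m F1 + B m F0 F0)))) 3 ?_ ?_ (by simp [hu0])
  · filter_upwards [hu] with h hh
    have := hh.sub ((((hasDerivAt_id h).smul_const F0).add
      ((hasDerivAt_pow 2 h).smul_const ((1 / 2 : ℝ) • F1))).add
      ((hasDerivAt_pow 3 h).smul_const ((1 / 6 : ℝ) • ∑ m, (L m F1 + B m F0 F0))))
    refine this.congr_deriv ?_
    push_cast
    module
  · have : (fun h => ∑ m, (f m (x + u h) - (f m x + h • L m F0 +
          h ^ 2 • (L m ((1 / 2 : ℝ) • F1) + (1 / 2 : ℝ) • B m F0 F0)))) =O[𝓝 0]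
          (fun h : ℝ => h ^ 3) :=
      IsBigO.fun_sum fun m _ => gark_expand3 (hT m) le_rfl e2
    refine this.congr_left fun h => ?_
    simp only [map_smul, ← smul_add]
    rw [Finset.sum_sub_distrib, Finset.sum_add_distrib, Finset.sum_add_distrib,
      ← Finset.smul_sum, ← Finset.smul_sum, ← Finset.smul_sum]

lemma gark_numeric {N s : ℕ} (a : Fin N → Fin N → Fin s → Fin s → ℝ)
    (haexp : ∀ q m i j, i ≤ j → a q m i j = 0) (b : Fin N → Fin s → ℝ)
    (f : Fin N → E → E) (x : E) (L : Fin N → E →L[ℝ] E)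
    (B : Fin N → E →L[ℝ] E →L[ℝ] E) (hT : ∀ m, GarkTaylor (f m) x (L m) (B m))
    (hl : l ≤ 𝓝 0) (U : ℝ → Fin N → Fin s → E)
    (hU : ∀ᶠ h in l, ∀ q i, U h q i = h • ∑ m, ∑ j, a q m i j • f m (x + U h m j))
    (v w : Fin N → Fin s → E) (hv : ∀ q i, v q i = ∑ m, ∑ j, a q m i j • f m x)
    (hw : ∀ q i, w q i = ∑ m, ∑ j, a q m i j • L m (v m j)) :
    (fun h => h • ∑ q, ∑ i, b q i • f q (x + U h q i) - h • ∑ q, ∑ i, b q i •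
      (f q x + h • L q (v q i) + h ^ 2 • (L q (w q i) + (1 / 2 : ℝ) • B q (v q i) (v q i))))
      =O[l] (fun h : ℝ => h ^ 4) := by
  have e0 : ∀ n : ℕ, ∀ i : Fin s, i.val = n → ∀ q,
      (fun h => U h q i) =O[l] (fun h : ℝ => h ^ 1) := by
    intro n
    induction n using Nat.strong_induction_on with
    | _ n ih =>
      intro i hi q
      have := gark_step (l := l) (a q · i ·) (fun h m j => f m (x + U h m j))
        (fun _ _ _ => 0) 0 (fun m j hc => by
          have hji : j < i := by
            by_contra hcon
            exact hc (haexp q m i j (not_lt.1 hcon))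
          have h1 := gark_expand1 (hT m) hl (ih j.val (by omega) j rfl m)
          have h2 := (h1.trans (gark_pow_le hl (show 0 ≤ 1 by norm_num))).add
            (gark_pow_smul hl (le_refl 0) (f m x))
          refine h2.congr_left fun h => ?_
          simp)
      refine this.congr' ?_ EventuallyEq.rfl
      filter_upwards [hU] with h hh
      rw [hh q i]
      simp
  have e1 : ∀ q i, (fun h => U h q i - h • v q i) =O[l] (fun h : ℝ => h ^ 2) := by
    intro q i
    have := gark_step (l := l) (a q · i ·) (fun h m j => f m (x + U h m j))
        (fun _ m _ => f m x) 1 (fun m j _ => gark_expand1 (hT m) hl (e0 _ j rfl m))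
    refine this.congr' ?_ EventuallyEq.rfl
    filter_upwards [hU] with h hh
    rw [hh q i, hv q i]
  have e2 : ∀ q i, (fun h => U h q i - (h • v q i + h ^ 2 • w q i)) =O[l]
      (fun h : ℝ => h ^ 3) := by
    intro q i
    have := gark_step (l := l) (a q · i ·) (fun h m j => f m (x + U h m j))
        (fun h m j => f m x + h • L m (v m j)) 2 (fun m j _ => gark_expand2 (hT m) hl (e1 m j))
    refine this.congr' ?_ EventuallyEq.rfl
    filter_upwards [hU] with h hh
    rw [hh q i, hv q i, hw q i]
    congr 1
    simp only [smul_add, Finset.sum_add_distrib, Finset.smul_sum, smul_smul]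
    congr 1
    refine Finset.sum_congr rfl fun m _ => Finset.sum_congr rfl fun j _ => ?_
    congr 1
    ring
  exact gark_step b _ _ 3 (fun q i _ => gark_expand3 (hT q) hl (e2 q i))

lemma gark_algebra {N s : ℕ} (a : Fin N → Fin N → Fin s → Fin s → ℝ) (b : Fin N → Fin s → ℝ)
    (hb1 : ∀ σ, ∑ i, b σ i = 1)
    (hb2 : ∀ σ ν, ∑ i, ∑ j, b σ i * a σ ν i j = 1 / 2)
    (hb3a : ∀ σ ν μ, ∑ i, ∑ j, ∑ k, b σ i * a σ ν i j * a σ μ i k = 1 / 3)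
    (hb3b : ∀ σ ν μ, ∑ i, ∑ j, ∑ k, b σ i * a σ ν i j * a ν μ j k = 1 / 6)
    (f : Fin N → E) (L : Fin N → E →L[ℝ] E) (B : Fin N → E →L[ℝ] E →L[ℝ] E)
    (v w : Fin N → Fin s → E) (hv : ∀ q i, v q i = ∑ m, ∑ j, a q m i j • f m)
    (hw : ∀ q i, w q i = ∑ m, ∑ j, a q m i j • L m (v m j)) (h : ℝ) :
    h • ∑ q, ∑ i, b q i •
      (f q + h • L q (v q i) + h ^ 2 • (L q (w q i) + (1 / 2 : ℝ) • B q (v q i) (v q i)))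
    = h • (∑ m, f m) + h ^ 2 • ((1 / 2 : ℝ) • ∑ m, L m (∑ r, f r)) +
      h ^ 3 • ((1 / 6 : ℝ) • ∑ m, (L m (∑ r, L r (∑ k, f k)) +
        B m (∑ r, f r) (∑ r, f r))) := by
  have k1 : ∀ q, ∑ i, b q i • f q = f q := fun q => by
    rw [← Finset.sum_smul, hb1, one_smul]
  have k2 : ∀ q, ∑ i, b q i • L q (v q i) = (1 / 2 : ℝ) • L q (∑ r, f r) := fun q => by
    simp only [hv, map_sum, map_smul, Finset.smul_sum, smul_smul]
    rw [Finset.sum_comm]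
    refine Finset.sum_congr rfl fun m _ => ?_
    rw [← hb2 q m]
    simp only [Finset.sum_smul]
  have k3 : ∀ q, ∑ i, b q i • L q (w q i) =
      (1 / 6 : ℝ) • L q (∑ r, L r (∑ k, f k)) := fun q => by
    simp only [hw, hv, map_sum, map_smul, Finset.smul_sum, smul_smul]
    rw [Finset.sum_comm]
    refine Finset.sum_congr rfl fun m _ => ?_
    have : ∀ i, ∑ j, ∑ r, ∑ k, (b q i * (a q m i j * a m r j k)) • L q (L m (f r)) =
        ∑ r, ∑ j, ∑ k, (b q i * (a q m i j * a m r j k)) • L q (L m (f r)) :=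
      fun i => Finset.sum_comm
    simp only [mul_assoc, this]
    rw [Finset.sum_comm]
    refine Finset.sum_congr rfl fun r _ => ?_
    rw [← hb3b q m r]
    simp only [Finset.sum_smul, mul_assoc]
  have k4 : ∀ q, ∑ i, b q i • B q (v q i) (v q i) =
      (1 / 3 : ℝ) • B q (∑ r, f r) (∑ r, f r) := fun q => by
    have hvc : ∀ i, v q i = ∑ m, (∑ j, a q m i j) • f m := fun i => by
      simp only [hv, Finset.sum_smul]
    simp only [hvc, map_sum, map_smul, ContinuousLinearMap.sum_apply,
      ContinuousLinearMap.smul_apply, Finset.smul_sum, smul_smul]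
    rw [Finset.sum_comm]
    refine Finset.sum_congr rfl fun m _ => ?_
    rw [Finset.sum_comm]
    refine Finset.sum_congr rfl fun r _ => ?_
    rw [← Finset.sum_smul]
    congr 1
    rw [← hb3a q r m]
    refine Finset.sum_congr rfl fun i _ => ?_
    simp only [Finset.mul_sum, Finset.sum_mul]
    refine Finset.sum_congr rfl fun j _ => Finset.sum_congr rfl fun k _ => ?_
    ring
  have key : ∀ q, ∑ i, b q i •
      (f q + h • L q (v q i) + h ^ 2 • (L q (w q i) + (1 / 2 : ℝ) • B q (v q i) (v q i))) =
      f q + h • ((1 / 2 : ℝ) • L q (∑ r, f r)) + h ^ 2 • ((1 / 6 : ℝ) •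
        (L q (∑ r, L r (∑ k, f k)) + B q (∑ r, f r) (∑ r, f r))) := fun q => by
    have : ∀ i, b q i •
        (f q + h • L q (v q i) + h ^ 2 • (L q (w q i) + (1 / 2 : ℝ) • B q (v q i) (v q i))) =
        b q i • f q + h • (b q i • L q (v q i)) + h ^ 2 • (b q i • L q (w q i)) +
        (h ^ 2 * (1 / 2)) • (b q i • B q (v q i) (v q i)) := fun i => by module
    simp only [this, Finset.sum_add_distrib, ← Finset.smul_sum, k1, k2, k3, k4]
    module
  simp only [key]
  rw [Finset.sum_add_distrib, Finset.sum_add_distrib, ← Finset.smul_sum, ← Finset.smul_sum,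
    ← Finset.smul_sum, ← Finset.smul_sum]
  module

end helpers

/-- An explicit GARK method satisfying the order conditions up to order
three produces, for three times continuously differentiable right hand side components,
a one-step numerical solution whose local error is `O(h⁴)`. -/
theorem gark_explicit_order_three_local_error
    (N s d : ℕ) (hN : 0 < N) (hs : 0 < s) (hd : 0 < d)
    (a : Fin N → Fin N → Fin s → Fin s → ℝ)
    (haexp : ∀ q m i j, i ≤ j → a q m i j = 0)
    (b : Fin N → Fin s → ℝ)
    (hb1 : ∀ σ, ∑ i, b σ i = 1)
    (hb2 : ∀ σ ν, ∑ i, ∑ j, b σ i * a σ ν i j = 1 / 2)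
    (hb3a : ∀ σ ν μ, ∑ i, ∑ j, ∑ k, b σ i * a σ ν i j * a σ μ i k = 1 / 3)
    (hb3b : ∀ σ ν μ, ∑ i, ∑ j, ∑ k, b σ i * a σ ν i j * a ν μ j k = 1 / 6)
    (f : Fin N → EuclideanSpace ℝ (Fin d) → EuclideanSpace ℝ (Fin d))
    (hf : ∀ m, ContDiff ℝ 3 (f m))
    (t₀ : ℝ) (y : ℝ → EuclideanSpace ℝ (Fin d))
    (hy : ∀ᶠ t in 𝓝 t₀, HasDerivAt y (∑ m, f m (y t)) t)
    (Y : ℝ → Fin N → Fin s → EuclideanSpace ℝ (Fin d))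
    (hY : ∀ h : ℝ, 0 ≤ h → ∀ q i,
      Y h q i = y t₀ + h • ∑ m, ∑ j ∈ Finset.Iio i, a q m i j • f m (Y h m j))
    (y1 : ℝ → EuclideanSpace ℝ (Fin d))
    (hy1 : ∀ h : ℝ, 0 ≤ h → y1 h = y t₀ + h • ∑ q, ∑ i, b q i • f q (Y h q i)) :
    ∃ C > 0, ∃ h₀ > 0, ∀ h : ℝ, 0 ≤ h → h ≤ h₀ →
      ‖y1 h - y (t₀ + h)‖ ≤ C * h ^ 4 := by
  have hTex : ∀ m, ∃ (L : EuclideanSpace ℝ (Fin d) →L[ℝ] EuclideanSpace ℝ (Fin d))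
      (B : EuclideanSpace ℝ (Fin d) →L[ℝ] EuclideanSpace ℝ (Fin d) →L[ℝ]
        EuclideanSpace ℝ (Fin d)), GarkTaylor (f m) (y t₀) L B :=
    fun m => gark_taylor (f m) (hf m) (y t₀)
  choose L B hT using hTex
  have hl : 𝓝[≥] (0 : ℝ) ≤ 𝓝 0 := nhdsWithin_le_nhds
  have hex := gark_exact_s17 f (y t₀) L B hT (fun h => y (t₀ + h) - y t₀) (by simp) (by
    have ht : Tendsto (fun h : ℝ => t₀ + h) (𝓝 0) (𝓝 t₀) := by
      have : Continuous (fun h : ℝ => t₀ + h) := by fun_prop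
      simpa using this.tendsto 0
    filter_upwards [ht.eventually hy] with h hh
    simpa using (hh.comp_const_add t₀ h).sub_const (y t₀))
  let v : Fin N → Fin s → EuclideanSpace ℝ (Fin d) :=
    fun q i => ∑ m, ∑ j, a q m i j • f m (y t₀)
  let w : Fin N → Fin s → EuclideanSpace ℝ (Fin d) :=
    fun q i => ∑ m, ∑ j, a q m i j • L m (v m j)
  have hnum := gark_numeric (l := 𝓝[≥] (0 : ℝ)) a haexp b f (y t₀) L B hT hl
    (fun h q i => Y h q i - y t₀) (by
      filter_upwards [self_mem_nhdsWithin] with h hh q i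
      have hh' : (0 : ℝ) ≤ h := hh
      rw [hY h hh' q i, add_sub_cancel_left]
      congr 1
      refine Finset.sum_congr rfl fun m _ => ?_
      simp only [add_sub_cancel]
      refine Finset.sum_subset (Finset.subset_univ _) fun j _ hj => ?_
      rw [haexp q m i j (by simpa using hj), zero_smul]) v w (fun _ _ => rfl) (fun _ _ => rfl)
  have hfin := hnum.sub (hex.mono hl)
  obtain ⟨C, hC0, hC⟩ := hfin.exists_pos
  rw [Asymptotics.IsBigOWith] at hC
  rw [eventually_nhdsWithin_iff, Metric.eventually_nhds_iff_ball] at hC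
  obtain ⟨r, hr, hball⟩ := hC
  refine ⟨C, hC0, r / 2, by positivity, fun h h0 hle => ?_⟩
  have := hball h (by rw [mem_ball_zero_iff, Real.norm_of_nonneg h0]; linarith) h0
  rw [Real.norm_of_nonneg (by positivity : (0 : ℝ) ≤ h ^ 4)] at this
  refine le_trans (le_of_eq ?_) this
  congr 1
  rw [gark_algebra a b hb1 hb2 hb3a hb3b (fun m => f m (y t₀)) L B v w
    (fun _ _ => rfl) (fun _ _ => rfl) h, hy1 h h0]
  simp only [add_sub_cancel]
  abel
end
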